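/- Fix t ∈ (0,1) and suppose (l_n) is a sequence with l_n ∈ {1,…,n} and l_n/n = t + O(1/√(log n)) as n → ∞. For each n, let X_{n,l_n} be the depth of the node containing l_n in the random binary search tree built from a uniformly random permutation of {1,…,n}. Let ν_{n,t} be the distribution of max(0, 2·log n + 2γ + log(t(1−t)) − 2E), where E is exponentially distributed with mean 1 and γ is Euler's constant. Then d_W(L(X_{n,l_n}), MixPo(ν_{n,t})) = O(1/√(log n)) as n → ∞; that is, there exist C < ∞ and n₀ such that d_W(L(X_{n,l_n}), MixPo(ν_{n,t})) ≤ C/√(log n) for all n ≥ n₀. -/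

import Mathlib

open MeasureTheory ProbabilityTheory Finset Filter
open scoped ENNReal NNReal

noncomputable section

/-- The `k`-th harmonic number `H_k = ∑_{i=1}^k 1/i`, with `H_0 = 0`. -/
def harm (k : ℕ) : ℝ := ∑ i ∈ Finset.range k, (1 : ℝ) / (i + 1)

instance (n : ℕ) : MeasurableSpace (Equiv.Perm (Fin n)) := ⊤

/-- The uniform distribution on the permutations of `{1,…,n}`. -/
def uniformPerm (n : ℕ) : Measure (Equiv.Perm (Fin n)) :=
  (PMF.uniformOfFintype (Equiv.Perm (Fin n))).toMeasure

/-- The (1-based) position `N = π⁻¹(l)` of the key `l` in the permutation `π`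
(positions are `i+1` for `i : Fin n`, values are `π i + 1`). -/
def bstN (n l : ℕ) (π : Equiv.Perm (Fin n)) : ℕ :=
  1 + ∑ i : Fin n, if (π i : ℕ) + 1 = l then (i : ℕ) else 0

open scoped Classical in
/-- `R₋`: the number of ascending records in the subpermutation of values `< l`
appearing before the position of `l`. -/
def bstRminus (n l : ℕ) (π : Equiv.Perm (Fin n)) : ℕ :=
  (Finset.univ.filter fun r : Fin n =>
    (r : ℕ) + 1 < bstN n l π ∧ (π r : ℕ) + 1 < l ∧
      ∀ k : Fin n, k < r → (π k : ℕ) + 1 < l → π k < π r).card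

open scoped Classical in
/-- `R₊`: the number of descending records in the subpermutation of values `> l`
appearing before the position of `l`. -/
def bstRplus (n l : ℕ) (π : Equiv.Perm (Fin n)) : ℕ :=
  (Finset.univ.filter fun r : Fin n =>
    (r : ℕ) + 1 < bstN n l π ∧ (π r : ℕ) + 1 > l ∧
      ∀ k : Fin n, k < r → (π k : ℕ) + 1 > l → π r < π k).card

/-- `X_{n,l} = R₋ + R₊`: the depth of the node containing `l` in the binary search
tree built from the permutation `π` of `{1,…,n}`. -/
def bstDepth (n l : ℕ) (π : Equiv.Perm (Fin n)) : ℕ :=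
  bstRminus n l π + bstRplus n l π

open scoped Classical in
/-- `G = #{1 ≤ i < N : π(i) < l}`. -/
def bstG (n l : ℕ) (π : Equiv.Perm (Fin n)) : ℕ :=
  (Finset.univ.filter fun i : Fin n =>
    (i : ℕ) + 1 < bstN n l π ∧ (π i : ℕ) + 1 < l).card

/-- The expectation `E X_{n,l}` of the depth of the node containing `l`. -/
def bstExp (n l : ℕ) : ℝ := ∫ π, (bstDepth n l π : ℝ) ∂(uniformPerm n)

/-- The hypergeometric probability mass function: for `X ~ HypGeo(N; M, n)`,
`P(X = k) = C(M,k)·C(N−M,n−k)/C(N,n)` for `0 ≤ k ≤ n` (and `0` otherwise). -/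
def hypPMF (N M n k : ℕ) : ℝ :=
  if k ≤ n then (M.choose k * (N - M).choose (n - k) : ℝ) / (N.choose n) else 0

/-- Total variation distance between (probability) measures on `ℕ`. -/
def dTV (μ ν : Measure ℕ) : ℝ := ⨆ A : Set ℕ, |(μ A).toReal - (ν A).toReal|

/-- The Wasserstein-type distance `d_W` of Barbour–Holst–Janson: the supremum of
`|∫ f dμ − ∫ f dν|` over measurable `f` with `|f(x) − f(y)| ≤ 1` whenever `|x − y| ≤ 1`. -/
def dW (μ ν : Measure ℝ) : ℝ :=
  sSup { d : ℝ | ∃ f : ℝ → ℝ, Measurable f ∧ (∀ x y, |x - y| ≤ 1 → |f x - f y| ≤ 1) ∧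
    d = |∫ x, f x ∂μ - ∫ x, f x ∂ν| }

/-- The mixed Poisson distribution with mixing measure `ν`:
`MixPo(ν)({k}) = ∫ e^{−λ} λ^k / k! ν(dλ)`. -/
def mixPo (ν : Measure ℝ) : Measure ℕ :=
  Measure.sum fun k =>
    (∫⁻ l, ENNReal.ofReal (Real.exp (-l) * l ^ k / k.factorial) ∂ν) • Measure.dirac k

/-- The standard normal cumulative distribution function `Φ`. -/
def stdNormalCDF (x : ℝ) : ℝ :=
  (1 / Real.sqrt (2 * Real.pi)) * ∫ y in Set.Iic x, Real.exp (-y ^ 2 / 2)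

end

/-- One step of adding an independent Bernoulli variable with success probability `p`. -/
noncomputable def bernoulliStep (p : ℝ) (F : ℕ → ℝ) (k : ℕ) : ℝ := F k + p * (F (k + 1) - F k)

/-- `recordOp g F k` is the expectation of `F (k + R)`, where `R` is the number of records of a
uniformly random permutation of `g` elements. -/
noncomputable def recordOp : ℕ → (ℕ → ℝ) → ℕ → ℝ
  | 0, F => F
  | g + 1, F => recordOp g (bernoulliStep (1 / ((g : ℝ) + 1)) F)

theorem bernoulliStep_comm (p q : ℝ) (F : ℕ → ℝ) :
    bernoulliStep p (bernoulliStep q F) = bernoulliStep q (bernoulliStep p F) := by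
  funext k; simp only [bernoulliStep]; ring

theorem recordOp_bernoulliStep (g : ℕ) (p : ℝ) (F : ℕ → ℝ) :
    recordOp g (bernoulliStep p F) = bernoulliStep p (recordOp g F) := by
  induction g generalizing F with
  | zero => rfl
  | succ g ih => rw [recordOp, recordOp, bernoulliStep_comm, ih]

theorem recordOp_comm (g h : ℕ) (F : ℕ → ℝ) :
    recordOp g (recordOp h F) = recordOp h (recordOp g F) := by
  induction g generalizing F with
  | zero => rfl
  | succ g ih => rw [recordOp, recordOp, ← recordOp_bernoulliStep, ih]

theorem recordOp_succ_mul (g : ℕ) (F : ℕ → ℝ) (k : ℕ) :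
    ((g : ℝ) + 1) * recordOp (g + 1) F k = g * recordOp g F k + recordOp g F (k + 1) := by
  rw [recordOp, recordOp_bernoulliStep, bernoulliStep]
  field_simp
  ring

/-- The permutation of `Fin (n + 1)` with last value `w` whose other values are order isomorphic
to `τ`. -/
def appendPerm {n : ℕ} (w : Fin (n + 1)) (τ : Equiv.Perm (Fin n)) : Equiv.Perm (Fin (n + 1)) :=
  ((finSuccEquiv' (Fin.last n)).trans τ.optionCongr).trans (finSuccEquiv' w).symm

@[simp] theorem appendPerm_last {n : ℕ} (w : Fin (n + 1)) (τ : Equiv.Perm (Fin n)) :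
    appendPerm w τ (Fin.last n) = w := by
  simp [appendPerm]

@[simp] theorem appendPerm_castSucc {n : ℕ} (w : Fin (n + 1)) (τ : Equiv.Perm (Fin n))
    (i : Fin n) : appendPerm w τ i.castSucc = w.succAbove (τ i) := by
  simp [appendPerm, finSuccEquiv'_last_apply_castSucc]

theorem appendPerm_bijective (n : ℕ) : Function.Bijective
    fun p : Fin (n + 1) × Equiv.Perm (Fin n) => appendPerm p.1 p.2 := by
  rw [Fintype.bijective_iff_injective_and_card]
  constructor
  · rintro ⟨w, τ⟩ ⟨w', τ'⟩ h
    simp only at h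
    have hw : w = w' := by
      simpa using congrArg (fun π : Equiv.Perm (Fin (n + 1)) => π (Fin.last n)) h
    subst hw
    refine Prod.ext rfl (Equiv.ext fun i => ?_)
    simpa using congrArg (fun π : Equiv.Perm (Fin (n + 1)) => π i.castSucc) h
  · simp [Fintype.card_perm, Nat.factorial_succ]

theorem sum_perm_succ {n : ℕ} (Φ : Equiv.Perm (Fin (n + 1)) → ℝ) :
    ∑ π, Φ π = ∑ w, ∑ τ, Φ (appendPerm w τ) := by
  rw [← Fintype.sum_prod_type' (fun w τ => Φ (appendPerm w τ))]
  exact (Function.Bijective.sum_comp (appendPerm_bijective n) Φ).symm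

theorem val_succAbove {n : ℕ} (w : Fin (n + 1)) (j : Fin n) :
    (w.succAbove j : ℕ) = if (j : ℕ) < w then (j : ℕ) else j + 1 := by
  rw [Fin.succAbove]
  simp only [Fin.lt_def, Fin.val_castSucc]
  split_ifs <;> simp

open scoped Classical in
/-- The number of comparisons made when inserting a new key into the gap `v`, below which there
are `v` keys. -/
noncomputable def gapDepth (n v : ℕ) (σ : Equiv.Perm (Fin n)) : ℕ :=
  (Finset.univ.filter fun r : Fin n =>
    (σ r : ℕ) < v ∧ ∀ k : Fin n, k < r → (σ k : ℕ) < v → σ k < σ r).card +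
  (Finset.univ.filter fun r : Fin n =>
    v ≤ (σ r : ℕ) ∧ ∀ k : Fin n, k < r → v ≤ (σ k : ℕ) → σ r < σ k).card

theorem bstN_eq {n l : ℕ} (π : Equiv.Perm (Fin n)) (p : Fin n) (hp : (π p : ℕ) + 1 = l) :
    bstN n l π = p + 1 := by
  rw [bstN, Finset.sum_eq_single p]
  · simp [hp, add_comm]
  · intro i _ hi
    rw [if_neg]
    intro h
    exact hi (π.injective (Fin.ext (by omega)))
  · simp

theorem forall_lt_castSucc {n : ℕ} (r : Fin n) (P : Fin (n + 1) → Prop) :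
    (∀ k : Fin (n + 1), k < r.castSucc → P k) ↔ ∀ k : Fin n, k < r → P k.castSucc := by
  constructor
  · intro h k hk
    exact h _ (by simpa using hk)
  · intro h k
    refine Fin.lastCases ?_ (fun i => ?_) k
    · intro hk
      exact absurd hk (by simp [Fin.le_last])
    · intro hk
      exact h i (by simpa using hk)

theorem bstDepth_appendPerm_eq {n l : ℕ} (w : Fin (n + 1)) (τ : Equiv.Perm (Fin n))
    (hw : (w : ℕ) + 1 = l) : bstDepth (n + 1) l (appendPerm w τ) = gapDepth n w τ := by
  have hN : bstN (n + 1) l (appendPerm w τ) = n + 1 := by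
    rw [bstN_eq _ (Fin.last n) (by simpa using hw)]
    simp
  subst hw
  simp only [bstDepth, bstRminus, bstRplus, gapDepth, hN, Finset.card_filter,
    Fin.sum_univ_castSucc, forall_lt_castSucc, appendPerm_castSucc, Fin.succAbove_lt_succAbove_iff,
    Fin.val_castSucc, Fin.val_last, appendPerm_last]
  simp only [lt_irrefl, false_and, if_false, add_zero]
  congr 1 <;> refine Finset.sum_congr rfl fun r _ => if_congr ?_ rfl rfl
  · have (j : Fin n) : (w.succAbove j : ℕ) + 1 < w + 1 ↔ (j : ℕ) < w := by
      rw [val_succAbove]; split_ifs <;> omega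
    simp only [this, Nat.add_lt_add_iff_right, r.isLt, true_and]
  · have (j : Fin n) : (w.succAbove j : ℕ) + 1 > w + 1 ↔ (w : ℕ) ≤ j := by
      rw [val_succAbove]; split_ifs <;> omega
    simp only [this, Nat.add_lt_add_iff_right, r.isLt, true_and]

/-- Deleting the last inserted key does not change the depth of another key. -/
theorem bstDepth_appendPerm_of_ne {n l l' : ℕ} (w : Fin (n + 1)) (τ : Equiv.Perm (Fin n))
    (j : Fin n) (hj : (j : ℕ) + 1 = l') (hl : (w.succAbove j : ℕ) + 1 = l) :
    bstDepth (n + 1) l (appendPerm w τ) = bstDepth n l' τ := by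
  obtain ⟨p, rfl⟩ := τ.surjective j
  have hN : bstN (n + 1) l (appendPerm w τ) = p + 1 := by
    rw [bstN_eq _ p.castSucc (by simpa using hl)]
    simp
  have hN' : bstN n l' τ = p + 1 := bstN_eq _ _ hj
  have hlt (i : Fin n) : (w.succAbove i : ℕ) + 1 < l ↔ (i : ℕ) + 1 < l' := by
    rw [← hj, ← hl, val_succAbove, val_succAbove]; split_ifs <;> omega
  have hgt (i : Fin n) : (w.succAbove i : ℕ) + 1 > l ↔ (i : ℕ) + 1 > l' := by
    rw [← hj, ← hl, val_succAbove, val_succAbove]; split_ifs <;> omega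
  have hp : ¬ (n + 1 < (p : ℕ) + 1) := by omega
  simp only [bstDepth, bstRminus, bstRplus, hN, hN', Finset.card_filter,
    Fin.sum_univ_castSucc, forall_lt_castSucc, appendPerm_castSucc, Fin.succAbove_lt_succAbove_iff,
    Fin.val_castSucc, Fin.val_last, appendPerm_last, hlt, hgt, hp, false_and, if_false, add_zero]

theorem gapDepth_appendPerm_lt {n v : ℕ} (w : Fin (n + 1)) (τ : Equiv.Perm (Fin n))
    (hw : (w : ℕ) < v + 1) (hv : v < n + 1) :
    gapDepth (n + 1) (v + 1) (appendPerm w τ) = gapDepth n v τ + if (w : ℕ) = v then 1 else 0 := by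
  have hlt (i : Fin n) : (w.succAbove i : ℕ) < v + 1 ↔ (i : ℕ) < v := by
    rw [val_succAbove]; split_ifs <;> omega
  have hle (i : Fin n) : v + 1 ≤ (w.succAbove i : ℕ) ↔ v ≤ (i : ℕ) := by
    rw [val_succAbove]; split_ifs <;> omega
  have hlast : (∀ k : Fin (n + 1), k < Fin.last n → (appendPerm w τ k : ℕ) < v + 1 →
      appendPerm w τ k < w) ↔ (w : ℕ) = v := by
    constructor
    · intro h
      by_contra hne
      obtain ⟨k, hk⟩ := (appendPerm w τ).surjective ⟨v, hv⟩
      have hkl : k < Fin.last n := by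
        refine lt_of_le_of_ne (Fin.le_last k) ?_
        rintro rfl
        rw [appendPerm_last] at hk
        exact hne (by rw [hk])
      have := h k hkl (by simp [hk])
      rw [hk, Fin.lt_def] at this
      simp only at this
      omega
    · intro h k hk hkv
      have : appendPerm w τ k ≠ w := by
        intro he
        rw [← appendPerm_last w τ] at he
        exact hk.ne ((appendPerm w τ).injective (by simpa using he))
      rw [Fin.lt_def]
      have := Fin.val_ne_of_ne this
      omega
  have hw' : ¬ (v + 1 ≤ (w : ℕ)) := by omega
  simp only [gapDepth, Finset.card_filter,
    Fin.sum_univ_castSucc, forall_lt_castSucc, appendPerm_castSucc, Fin.succAbove_lt_succAbove_iff,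
    appendPerm_last, hlt, hle, hlast, hw, hw', false_and, true_and, if_false, add_zero]
  omega

theorem gapDepth_appendPerm_ge {n v : ℕ} (w : Fin (n + 1)) (τ : Equiv.Perm (Fin n))
    (hw : v ≤ (w : ℕ)) :
    gapDepth (n + 1) v (appendPerm w τ) = gapDepth n v τ + if (w : ℕ) = v then 1 else 0 := by
  have hlt (i : Fin n) : (w.succAbove i : ℕ) < v ↔ (i : ℕ) < v := by
    rw [val_succAbove]; split_ifs <;> omega
  have hle (i : Fin n) : v ≤ (w.succAbove i : ℕ) ↔ v ≤ (i : ℕ) := by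
    rw [val_succAbove]; split_ifs <;> omega
  have hlast : (∀ k : Fin (n + 1), k < Fin.last n → v ≤ (appendPerm w τ k : ℕ) →
      w < appendPerm w τ k) ↔ (w : ℕ) = v := by
    constructor
    · intro h
      by_contra hne
      obtain ⟨k, hk⟩ := (appendPerm w τ).surjective ⟨v, by omega⟩
      have hkl : k < Fin.last n := by
        refine lt_of_le_of_ne (Fin.le_last k) ?_
        rintro rfl
        rw [appendPerm_last] at hk
        exact hne (by rw [hk])
      have := h k hkl (by simp [hk])
      rw [hk, Fin.lt_def] at this
      simp only at this
      omega
    · intro h k hk hkv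
      have : appendPerm w τ k ≠ w := by
        intro he
        rw [← appendPerm_last w τ] at he
        exact hk.ne ((appendPerm w τ).injective (by simpa using he))
      rw [Fin.lt_def]
      have := Fin.val_ne_of_ne this
      omega
  have hw' : ¬ ((w : ℕ) < v) := by omega
  simp only [gapDepth, Finset.card_filter,
    Fin.sum_univ_castSucc, forall_lt_castSucc, appendPerm_castSucc, Fin.succAbove_lt_succAbove_iff,
    appendPerm_last, hlt, hle, hlast, hw, hw', false_and, true_and, if_false, add_zero]
  omega

theorem sum_fin_gap (a b : ℕ) (Φ : ℕ → ℝ) :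
    ∑ w : Fin (a + b), Φ w = ∑ w ∈ range a, Φ w + ∑ w ∈ range b, Φ (a + w) := by
  rw [Fin.sum_univ_eq_sum_range, Finset.sum_range_add]

theorem recordOp_shift (g c : ℕ) (F : ℕ → ℝ) (k : ℕ) :
    recordOp g (fun j => F (j + c)) k = recordOp g F (k + c) := by
  induction g generalizing F with
  | zero => rfl
  | succ g ih =>
    rw [recordOp, recordOp, ← ih]
    congr 1
    funext j
    simp only [bernoulliStep, add_right_comm]

theorem sum_range_ite_recordOp (a : ℕ) (F : ℕ → ℝ) :
    ∑ w ∈ range a, recordOp (a - 1) F (if w = a - 1 then 1 else 0) = a * recordOp a F 0 := by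
  cases a with
  | zero => simp
  | succ a =>
    rw [Finset.sum_range_succ, Finset.sum_congr rfl (g := fun _ => recordOp a F 0)]
    · push_cast
      rw [recordOp_succ_mul]
      simp
    · intro w hw
      rw [if_neg (by simp at hw ⊢; omega)]
      rfl

theorem sum_range_ite_recordOp' (b : ℕ) (F : ℕ → ℝ) :
    ∑ w ∈ range b, recordOp (b - 1) F (if w = 0 then 1 else 0) = b * recordOp b F 0 := by
  cases b with
  | zero => simp
  | succ b =>
    rw [Finset.sum_range_succ']
    push_cast
    rw [recordOp_succ_mul]
    simp

theorem sum_gapDepth (n : ℕ) : ∀ (a b : ℕ) (_ : a + b = n) (F : ℕ → ℝ),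
    ∑ σ : Equiv.Perm (Fin n), F (gapDepth n a σ) =
      n.factorial * recordOp a (recordOp b F) 0 := by
  induction n with
  | zero =>
    intro a b hab F
    obtain ⟨rfl, rfl⟩ : a = 0 ∧ b = 0 := by omega
    simp [gapDepth, recordOp]
  | succ n ih =>
    intro a b hab F
    have hshift (g h c : ℕ) : recordOp g (recordOp h fun k => F (k + c)) 0 =
        recordOp g (recordOp h F) c := by
      have : recordOp h (fun k => F (k + c)) = fun k => recordOp h F (k + c) := by
        funext k; exact recordOp_shift h c F k
      rw [this, recordOp_shift, zero_add]
    have hsplit : ∀ w : Fin (n + 1), ∑ τ, F (gapDepth (n + 1) a (appendPerm w τ)) =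
        n.factorial * (if (w : ℕ) < a then
          recordOp (a - 1) (recordOp b F) (if (w : ℕ) = a - 1 then 1 else 0)
        else recordOp (b - 1) (recordOp a F) (if (w : ℕ) = a then 1 else 0)) := by
      intro w
      split_ifs with h1 h2 h2
      all_goals
        first
        | obtain ⟨v, rfl⟩ : ∃ v, a = v + 1 := ⟨a - 1, by omega⟩
          simp_rw [gapDepth_appendPerm_lt w _ h1 (by omega)]
          rw [ih v b (by omega) (fun k => F (k + _)), hshift]
          simp_all
        | simp_rw [gapDepth_appendPerm_ge w _ (not_lt.1 h1)]
          rw [ih a (b - 1) (by omega) (fun k => F (k + _)), hshift, recordOp_comm]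
          simp_all
    rw [sum_perm_succ, Finset.sum_congr rfl fun w _ => hsplit w, ← Finset.mul_sum]
    have hn : n + 1 = a + b := hab.symm
    have hsum := sum_fin_gap a b fun w => if w < a then
          recordOp (a - 1) (recordOp b F) (if w = a - 1 then 1 else 0)
        else recordOp (b - 1) (recordOp a F) (if w = a then 1 else 0)
    rw [← hn] at hsum
    rw [hsum, Finset.sum_congr rfl fun w hw => if_pos (Finset.mem_range.1 hw),
      sum_range_ite_recordOp]
    simp only [add_lt_iff_neg_left, not_lt_zero, if_false, Nat.add_eq_left,
      sum_range_ite_recordOp']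
    rw [recordOp_comm b a, ← add_mul, Nat.factorial_succ, hn]
    push_cast
    ring

/-- The average of `F` over the depth of the node with `a` smaller and `b` larger keys. -/
noncomputable def depthMean (a b : ℕ) (F : ℕ → ℝ) : ℝ :=
  (∑ π : Equiv.Perm (Fin (a + b + 1)), F (bstDepth (a + b + 1) (a + 1) π)) / (a + b + 1).factorial

theorem depthMean_rec (a b : ℕ) (F : ℕ → ℝ) :
    ((a : ℝ) + b + 1) * depthMean a b F =
      a * depthMean (a - 1) b F + b * depthMean a (b - 1) F + recordOp a (recordOp b F) 0 := by
  have hsplit : ∀ w : Fin (a + b + 1),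
      ∑ τ, F (bstDepth (a + b + 1) (a + 1) (appendPerm w τ)) =
        (a + b).factorial * (if (w : ℕ) < a then depthMean (a - 1) b F
        else if (w : ℕ) = a then recordOp a (recordOp b F) 0 else depthMean a (b - 1) F) := by
    intro w
    split_ifs with h1 h2
    · obtain ⟨v, rfl⟩ : ∃ v, a = v + 1 := ⟨a - 1, by omega⟩
      have hab : v + 1 + b = v + b + 1 := by omega
      revert w
      rw [hab]
      intro w h1
      have hw : (w.succAbove ⟨v, by omega⟩ : ℕ) + 1 = v + 1 + 1 := by
        rw [val_succAbove, if_neg]; simp only; omega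
      simp_rw [bstDepth_appendPerm_of_ne w _ ⟨v, by omega⟩ rfl hw]
      simp only [depthMean, Nat.add_sub_cancel]
      field_simp
      rfl
    · simp_rw [bstDepth_appendPerm_eq w _ (show (w : ℕ) + 1 = a + 1 by omega), h2]
      exact sum_gapDepth _ a b rfl F
    · obtain ⟨v, rfl⟩ : ∃ v, b = v + 1 := ⟨b - 1, by omega⟩
      have hw : (w.succAbove ⟨a, by omega⟩ : ℕ) + 1 = a + 1 := by
        rw [val_succAbove, if_pos]; simp only; omega
      simp_rw [bstDepth_appendPerm_of_ne w _ ⟨a, by omega⟩ rfl hw]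
      simp only [depthMean, Nat.add_sub_cancel, ← add_assoc]
      field_simp
      rfl
  have hsum := sum_fin_gap a (b + 1) fun w => if w < a then depthMean (a - 1) b F
        else if w = a then recordOp a (recordOp b F) 0 else depthMean a (b - 1) F
  rw [← add_assoc, Finset.sum_congr rfl fun w hw => if_pos (Finset.mem_range.1 hw),
    Finset.sum_range_succ'] at hsum
  simp at hsum
  conv_lhs => rw [depthMean]
  rw [sum_perm_succ, Finset.sum_congr rfl fun w _ => hsplit w, ← Finset.mul_sum, hsum,
    Nat.factorial_succ]
  push_cast
  field_simp
  ring

/-- The exponential generating function of `a`. -/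
noncomputable def egf (a : ℕ → ℝ) (μ : ℝ) : ℝ := ∑' j : ℕ, μ ^ j / j.factorial * a j

/-- Sequences of at most geometric growth with ratio `2`. -/
def GeomBounded (a : ℕ → ℝ) : Prop := ∃ C, ∀ j, |a j| ≤ C * 2 ^ j

theorem GeomBounded.shift {a : ℕ → ℝ} (ha : GeomBounded a) (k : ℕ) :
    GeomBounded fun j => a (k + j) := by
  obtain ⟨C, hC⟩ := ha
  refine ⟨C * 2 ^ k, fun j => (hC _).trans_eq ?_⟩
  rw [pow_add]; ring

theorem geomBounded_of_abs_le {a : ℕ → ℝ} {c : ℝ} (h : ∀ j, |a j| ≤ c) : GeomBounded a := by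
  refine ⟨c, fun j => (h j).trans ?_⟩
  have : 0 ≤ c := (abs_nonneg _).trans (h 0)
  exact le_mul_of_one_le_right this (one_le_pow₀ (by norm_num))

theorem geomBounded_of_abs_le_add {a : ℕ → ℝ} {c : ℝ} (hc : 0 ≤ c) (h : ∀ j : ℕ, |a j| ≤ c + j) :
    GeomBounded a := by
  refine ⟨c + 1, fun j => (h j).trans ?_⟩
  have h1 : (1 : ℝ) ≤ 2 ^ j := one_le_pow₀ (by norm_num)
  have h2 : (j : ℝ) ≤ 2 ^ j := by exact_mod_cast (Nat.lt_two_pow_self).le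
  nlinarith

theorem GeomBounded.summable_norm {a : ℕ → ℝ} (ha : GeomBounded a) (μ : ℝ) :
    Summable fun j : ℕ => ‖μ ^ j / j.factorial * a j‖ := by
  obtain ⟨C, hC⟩ := ha
  refine Summable.of_nonneg_of_le (fun _ => norm_nonneg _) (fun j => ?_)
    ((Real.summable_pow_div_factorial (2 * |μ|)).mul_left C)
  rw [Real.norm_eq_abs, abs_mul, abs_div, abs_pow, Nat.abs_cast, mul_pow]
  calc |μ| ^ j / j.factorial * |a j| ≤ |μ| ^ j / j.factorial * (C * 2 ^ j) := by
        gcongr; exact hC j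
    _ = _ := by ring

theorem GeomBounded.summable {a : ℕ → ℝ} (ha : GeomBounded a) (μ : ℝ) :
    Summable fun j : ℕ => μ ^ j / j.factorial * a j := (ha.summable_norm μ).of_norm

theorem HasSum.of_eq {f g : ℕ → ℝ} {s t : ℝ} (h : HasSum f s) (hfg : ∀ j, g j = f j)
    (hst : t = s) : HasSum g t := by
  rw [funext hfg, hst]; exact h

theorem hasSum_pow_div_factorial_mul_self {a : ℕ → ℝ} {μ s : ℝ}
    (h : HasSum (fun j : ℕ => μ ^ j / j.factorial * a (j + 1)) s) :
    HasSum (fun j : ℕ => μ ^ j / j.factorial * (j * a j)) (μ * s) := by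
  rw [← hasSum_nat_add_iff' 1]
  simp only [Finset.sum_range_one, Nat.cast_zero, zero_mul, mul_zero, sub_zero]
  refine (h.mul_left μ).congr_fun ?_
  intro j
  rw [Nat.factorial_succ]
  push_cast
  field_simp
  ring

theorem hasDerivAt_egf {a : ℕ → ℝ} (ha : GeomBounded a) (μ : ℝ) :
    HasDerivAt (egf a) (egf (fun j => a (j + 1)) μ) μ := by
  obtain ⟨C, hC⟩ := ha
  have hC0 : 0 ≤ C := by simpa using (abs_nonneg _).trans (hC 0)
  set R := |μ| + 1 with hR
  have hder := hasDerivAt_tsum_of_isPreconnected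
    (u := fun j : ℕ => (j : ℝ) * R ^ (j - 1) / j.factorial * (C * 2 ^ j))
    (g := fun (j : ℕ) x => x ^ j / j.factorial * a j)
    (g' := fun (j : ℕ) x => (j : ℝ) * x ^ (j - 1) / j.factorial * a j)
    (t := Metric.ball 0 R) (y₀ := μ) (y := μ) ?_ Metric.isOpen_ball
    (convex_ball _ _).isPreconnected ?_ ?_ (by simp [hR])
    (GeomBounded.summable ⟨C, hC⟩ μ) (by simp [hR])
  · refine hder.congr_deriv ?_
    have hs : HasSum (fun j : ℕ => μ ^ j / j.factorial * a (1 + j)) (egf (fun j => a (1 + j)) μ) :=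
      (GeomBounded.summable (GeomBounded.shift ⟨C, hC⟩ 1) μ).hasSum
    refine HasSum.tsum_eq ?_
    rw [← hasSum_nat_add_iff' 1]
    simp only [Finset.sum_range_one, Nat.cast_zero, zero_mul, zero_div, sub_zero]
    refine hs.of_eq (fun j => ?_) (by simp only [add_comm 1])
    rw [add_comm 1]
    rw [Nat.factorial_succ, Nat.add_sub_cancel]
    push_cast
    field_simp
  · rw [← summable_nat_add_iff 1]
    refine ((Real.summable_pow_div_factorial (2 * R)).mul_left (2 * C)).congr ?_
    intro j
    rw [Nat.factorial_succ, Nat.add_sub_cancel]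
    push_cast
    field_simp
    ring_nf
  · intro j y _
    exact ((hasDerivAt_pow j y).div_const _).mul_const _
  · intro j y hy
    have hy : |y| ≤ R := by simpa using (Metric.mem_ball.1 hy).le
    rw [Real.norm_eq_abs, abs_mul, abs_div, abs_mul, abs_pow, Nat.abs_cast, Nat.abs_cast]
    gcongr
    exact hC j

/-- `poissonOp μ f k` is the expectation of `f (k + Z)` for a Poisson variable `Z` of mean `μ`. -/
noncomputable def poissonOp (μ : ℝ) (f : ℕ → ℝ) (k : ℕ) : ℝ :=
  Real.exp (-μ) * egf (fun j => f (k + j)) μ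

theorem hasDerivAt_poissonOp {f : ℕ → ℝ} (hf : GeomBounded f) (k : ℕ) (μ : ℝ) :
    HasDerivAt (fun μ => poissonOp μ f k) (poissonOp μ (fun j => f (j + 1) - f j) k) μ := by
  have h1 := hasDerivAt_egf (hf.shift k) μ
  have h2 : HasDerivAt (fun μ : ℝ => Real.exp (-μ)) (-Real.exp (-μ)) μ := by
    simpa using (hasDerivAt_neg μ).exp
  refine (h2.mul h1).congr_deriv ?_
  have h3 : egf (fun j => f (k + j + 1) - f (k + j)) μ =
      egf (fun j => f (k + (j + 1))) μ - egf (fun j => f (k + j)) μ := by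
    rw [egf, egf, egf, ← Summable.tsum_sub ((hf.shift (k + 1)).summable μ |>.congr fun j => by
      rw [add_right_comm, add_assoc]) ((hf.shift k).summable μ)]
    refine tsum_congr fun j => ?_
    rw [add_assoc]; ring
  change _ = Real.exp (-μ) * egf (fun j => f (k + j + 1) - f (k + j)) μ
  rw [h3]
  ring

theorem poissonOp_succ_sub {f : ℕ → ℝ} (hf : GeomBounded f) (k : ℕ) (μ : ℝ) :
    poissonOp μ (fun j => f (j + 1) - f j) k = poissonOp μ f (k + 1) - poissonOp μ f k := by
  rw [poissonOp, poissonOp, poissonOp, ← mul_sub, egf, egf, egf,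
    ← Summable.tsum_sub ((hf.shift (k + 1)).summable μ) ((hf.shift k).summable μ)]
  congr 1
  refine tsum_congr fun j => ?_
  rw [add_right_comm]; ring

theorem hasSum_pow_div_factorial (μ : ℝ) :
    HasSum (fun j : ℕ => μ ^ j / j.factorial) (Real.exp μ) := by
  rw [Real.exp_eq_exp_ℝ]
  exact NormedSpace.expSeries_div_hasSum_exp μ

theorem abs_poissonOp_le {f : ℕ → ℝ} {c μ : ℝ} (hμ : 0 ≤ μ) (h : ∀ j, |f j| ≤ c) (k : ℕ) :
    |poissonOp μ f k| ≤ c := by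
  have h1 : |egf (fun j => f (k + j)) μ| ≤ Real.exp μ * c := by
    have hb : GeomBounded fun j => f (k + j) := (geomBounded_of_abs_le h).shift k
    refine (norm_tsum_le_tsum_norm (hb.summable_norm μ)).trans ?_
    refine hasSum_le (fun j => ?_) (hb.summable_norm μ).hasSum
      ((hasSum_pow_div_factorial μ).mul_right c)
    rw [norm_mul, Real.norm_of_nonneg (by positivity)]
    gcongr
    exact h _
  rw [poissonOp, abs_mul, abs_of_pos (Real.exp_pos _)]
  calc Real.exp (-μ) * |egf (fun j => f (k + j)) μ| ≤ Real.exp (-μ) * (Real.exp μ * c) := by gcongr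
    _ = c := by rw [← mul_assoc, ← Real.exp_add]; simp

theorem hasSum_poisson_variance {μ : ℝ} :
    HasSum (fun j : ℕ => μ ^ j / j.factorial * ((j : ℝ) - μ) ^ 2) (μ * Real.exp μ) := by
  have h0 := hasSum_pow_div_factorial μ
  have h1 : HasSum (fun j : ℕ => μ ^ j / j.factorial * (j : ℝ)) (μ * Real.exp μ) := by
    have := hasSum_pow_div_factorial_mul_self (a := fun _ => 1) (μ := μ) (by simpa using h0)
    simpa using this
  have h2 : HasSum (fun j : ℕ => μ ^ j / j.factorial * ((j : ℝ) * j))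
      (μ * (μ * Real.exp μ + Real.exp μ)) := by
    refine hasSum_pow_div_factorial_mul_self (a := fun j => (j : ℝ)) ?_
    refine (h1.add h0).congr_fun fun j => ?_
    push_cast; ring
  refine ((h2.sub (h1.mul_left (2 * μ))).add (h0.mul_left (μ ^ 2))).of_eq (fun j => ?_) ?_ <;> ring

/-- Smoothing property of the Poisson distribution. -/
theorem abs_poissonOp_diff_le {g : ℕ → ℝ} {μ : ℝ} (hμ : 0 < μ) (h : ∀ j, |g j| ≤ 1) (k : ℕ) :
    |poissonOp μ (fun j => g (j + 1) - g j) k| ≤ 1 / √μ := by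
  set a : ℕ → ℝ := fun j => g (k + j)
  have hb : GeomBounded a := (geomBounded_of_abs_le h).shift k
  have h1 : HasSum (fun j : ℕ => μ ^ j / j.factorial * (j * a j)) (μ * egf (fun j => a (j + 1)) μ) :=
    hasSum_pow_div_factorial_mul_self
      (((hb.shift 1).summable μ).hasSum.of_eq (fun j => by rw [add_comm])
        (by simp only [egf, add_comm 1]))
  have h2 : HasSum (fun j : ℕ => μ ^ j / j.factorial * a j) (egf a μ) := (hb.summable μ).hasSum
  have h3 : HasSum (fun j : ℕ => μ ^ j / j.factorial * (((j : ℝ) / μ - 1) * a j))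
      (egf (fun j => a (j + 1)) μ - egf a μ) := by
    refine ((h1.mul_left μ⁻¹).sub h2).of_eq (fun j => ?_) ?_
    · field_simp
    · field_simp
  have hs := Real.sq_sqrt hμ.le
  have hs0 : 0 < √μ := Real.sqrt_pos.2 hμ
  have h4 : HasSum (fun j : ℕ => μ ^ j / j.factorial * ((√μ * ((j : ℝ) / μ - 1) ^ 2 + 1 / √μ) / 2))
      (Real.exp μ * (1 / √μ)) := by
    refine (((hasSum_poisson_variance (μ := μ)).mul_left (√μ / μ ^ 2 / 2)).add
      ((hasSum_pow_div_factorial μ).mul_right (1 / √μ / 2))).of_eq (fun j => ?_) ?_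
    · field_simp
    · field_simp
      rw [hs]; ring
  have h5 : |egf (fun j => a (j + 1)) μ - egf a μ| ≤ Real.exp μ * (1 / √μ) := by
    have hle (j : ℕ) : ‖μ ^ j / j.factorial * (((j : ℝ) / μ - 1) * a j)‖ ≤
        μ ^ j / j.factorial * ((√μ * ((j : ℝ) / μ - 1) ^ 2 + 1 / √μ) / 2) := by
      rw [norm_mul, Real.norm_of_nonneg (by positivity)]
      gcongr
      rw [norm_mul, Real.norm_eq_abs, Real.norm_eq_abs]
      set z := (j : ℝ) / μ - 1
      have hz : |z| ≤ (√μ * z ^ 2 + 1 / √μ) / 2 := by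
        rw [le_div_iff₀ two_pos, ← sq_abs z, ← sub_nonneg]
        have : √μ * |z| ^ 2 + 1 / √μ - |z| * 2 = (√μ * |z| - 1) ^ 2 / √μ := by
          field_simp; ring
        rw [this]; positivity
      exact (mul_le_of_le_one_right (abs_nonneg _) (h _)).trans hz
    have := tsum_of_norm_bounded h4 hle
    rwa [h3.tsum_eq] at this
  have h6 : poissonOp μ (fun j => g (j + 1) - g j) k =
      Real.exp (-μ) * (egf (fun j => a (j + 1)) μ - egf a μ) := by
    rw [poissonOp_succ_sub (geomBounded_of_abs_le h), poissonOp, poissonOp, ← mul_sub]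
    simp only [a, add_assoc, add_comm 1]
  rw [h6, abs_mul, abs_of_pos (Real.exp_pos _)]
  calc _ ≤ Real.exp (-μ) * (Real.exp μ * (1 / √μ)) := by gcongr
    _ = _ := by rw [← mul_assoc, ← Real.exp_add]; simp

theorem abs_poissonOp_diff_le' {g : ℕ → ℝ} {μ : ℝ} (hμ : 0 ≤ μ) (h : ∀ j, |g j| ≤ 1) (k : ℕ) :
    |poissonOp μ (fun j => g (j + 1) - g j) k| ≤ 3 / (1 + √μ) := by
  have h1 : |poissonOp μ (fun j => g (j + 1) - g j) k| ≤ 2 := by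
    refine abs_poissonOp_le hμ (fun j => (abs_sub _ _).trans ?_) k
    linarith [h (j + 1), h j]
  rw [le_div_iff₀ (by positivity)]
  rcases hμ.eq_or_lt with rfl | hpos
  · simp only [Real.sqrt_zero]; linarith
  · have h2 := abs_poissonOp_diff_le hpos h k
    rw [le_div_iff₀ (Real.sqrt_pos.2 hpos)] at h2
    linarith

theorem abs_poissonOp_sub_le {f : ℕ → ℝ} (hf : GeomBounded f) {M : ℝ} {μ ν : ℝ} (k : ℕ)
    (hM : ∀ ξ, min μ ν ≤ ξ → |poissonOp ξ (fun j => f (j + 1) - f j) k| ≤ M) :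
    |poissonOp μ f k - poissonOp ν f k| ≤ M * |μ - ν| := by
  refine (convex_Ici (min μ ν)).norm_image_sub_le_of_norm_hasDerivWithin_le
    (fun ξ _ => (hasDerivAt_poissonOp hf k ξ).hasDerivWithinAt) (fun ξ hξ => hM ξ hξ)
    (Set.mem_Ici.2 (min_le_right _ _)) (Set.mem_Ici.2 (min_le_left _ _))

theorem geomBounded_of_lip {f : ℕ → ℝ} (hf : ∀ j, |f (j + 1) - f j| ≤ 1) : GeomBounded f := by
  refine geomBounded_of_abs_le_add (abs_nonneg (f 0)) fun j => ?_
  induction j with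
  | zero => simp
  | succ j ih =>
    have := abs_sub_abs_le_abs_sub (f (j + 1)) (f j)
    push_cast
    linarith [hf j]

theorem abs_poissonOp_sub_le_of_lip {f : ℕ → ℝ} (hf : ∀ j, |f (j + 1) - f j| ≤ 1) {μ ν : ℝ}
    (hμ : 0 ≤ μ) (hν : 0 ≤ ν) (k : ℕ) : |poissonOp μ f k - poissonOp ν f k| ≤ |μ - ν| := by
  simpa using abs_poissonOp_sub_le (geomBounded_of_lip hf) (M := 1) (μ := μ) (ν := ν) k fun ξ hξ =>
    abs_poissonOp_le ((le_min hμ hν).trans hξ) hf k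

/-- Replacing one Bernoulli variable by a Poisson variable of the same mean. -/
theorem abs_bernoulliStep_poissonOp_sub_le {f : ℕ → ℝ} (hf : ∀ j, |f (j + 1) - f j| ≤ 1) {μ p : ℝ}
    (hμ : 0 ≤ μ) (hp : 0 ≤ p) (k : ℕ) :
    |bernoulliStep p (poissonOp μ f) k - poissonOp (μ + p) f k| ≤ 3 * p ^ 2 / (1 + √μ) := by
  set g : ℕ → ℝ := fun j => f (j + 1) - f j with hg
  have hgf := geomBounded_of_lip hf
  have h1 (ξ : ℝ) (hξ : ξ ∈ Set.Icc μ (μ + p)) :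
      ‖poissonOp ξ g k - poissonOp μ g k‖ ≤ 3 / (1 + √μ) * p := by
    refine (abs_poissonOp_sub_le (geomBounded_of_abs_le hf) (μ := ξ) (ν := μ) k
      (M := 3 / (1 + √μ)) fun ζ hζ => ?_).trans ?_
    · rw [min_eq_right hξ.1] at hζ
      refine (abs_poissonOp_diff_le' (hμ.trans hζ) hf k).trans ?_
      gcongr
    · gcongr
      rw [abs_of_nonneg (by linarith [hξ.1])]
      linarith [hξ.2]
  have h2 := (convex_Icc μ (μ + p)).norm_image_sub_le_of_norm_hasDerivWithin_le
    (f := fun ξ => poissonOp ξ f k - ξ * poissonOp μ g k)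
    (fun ξ _ => ((hasDerivAt_poissonOp hgf k ξ).sub
      ((hasDerivAt_id ξ).mul_const _)).hasDerivWithinAt) (C := 3 / (1 + √μ) * p)
      (fun ξ hξ => by simpa using h1 ξ hξ)
    (Set.left_mem_Icc.2 (by linarith)) (Set.right_mem_Icc.2 (by linarith))
  have h3 : bernoulliStep p (poissonOp μ f) k = poissonOp μ f k + p * poissonOp μ g k := by
    rw [bernoulliStep, hg, poissonOp_succ_sub hgf]
  rw [h3, abs_sub_comm]
  refine le_of_eq_of_le ?_ (h2.trans_eq ?_)
  · rw [Real.norm_eq_abs]; congr 1; ring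
  · rw [add_sub_cancel_left, Real.norm_of_nonneg hp]; ring

theorem abs_recordOp_sub_le {c : ℝ} (g : ℕ) {F G : ℕ → ℝ} (h : ∀ k, |F k - G k| ≤ c) (k : ℕ) :
    |recordOp g F k - recordOp g G k| ≤ c := by
  induction g generalizing F G with
  | zero => exact h k
  | succ g ih =>
    refine ih fun j => ?_
    have hp0 : 0 ≤ 1 / ((g : ℝ) + 1) := by positivity
    have hp1 : 1 / ((g : ℝ) + 1) ≤ 1 := by
      rw [div_le_one (by positivity)]; linarith [(Nat.cast_nonneg g : (0 : ℝ) ≤ g)]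
    simp only [bernoulliStep]
    set p := 1 / ((g : ℝ) + 1)
    have h1 := abs_le.1 (h j)
    have h2 := abs_le.1 (h (j + 1))
    rw [abs_le]
    constructor <;> nlinarith

theorem harm_succ (i : ℕ) : harm (i + 1) = harm i + 1 / ((i : ℝ) + 1) := by
  rw [harm, Finset.sum_range_succ, harm]

theorem harm_mono : Monotone harm := by
  refine monotone_nat_of_le_succ fun i => ?_
  rw [harm_succ]
  have : 0 ≤ 1 / ((i : ℝ) + 1) := by positivity
  linarith

theorem harm_nonneg (i : ℕ) : 0 ≤ harm i := Finset.sum_nonneg fun _ _ => by positivity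

theorem harm_eq (i : ℕ) : harm i = (harmonic i : ℝ) := by
  simp [harm, harmonic]

theorem abs_recordOp_poissonOp_sub_le {f : ℕ → ℝ} (hf : ∀ j, |f (j + 1) - f j| ≤ 1) (i : ℕ) :
    ∀ {ν : ℝ} (_ : 0 ≤ ν) (k : ℕ),
      |recordOp i (poissonOp ν f) k - poissonOp (ν + harm i) f k| ≤
        ∑ j ∈ range i, 3 * (1 / ((j : ℝ) + 1)) ^ 2 / (1 + √(ν + harm i - harm (j + 1))) := by
  induction i with
  | zero => intro ν _ k; simp [recordOp, harm]
  | succ i ih =>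
    intro ν hν k
    set p := 1 / ((i : ℝ) + 1) with hp
    have hp0 : 0 ≤ p := by positivity
    have h1 := abs_recordOp_sub_le i (abs_bernoulliStep_poissonOp_sub_le hf hν hp0) k
    have h2 := ih (add_nonneg hν hp0) k
    rw [Finset.sum_range_succ, recordOp, add_comm (Finset.sum _ _)]
    have e : ν + harm (i + 1) = ν + p + harm i := by rw [harm_succ]; ring
    rw [add_sub_cancel_right, e]
    exact (abs_sub_le _ _ _).trans (add_le_add h1 h2)

theorem log_sub_log_le_harm_sub {i g : ℕ} (h : i ≤ g) :
    Real.log (g + 1) - Real.log (i + 1) ≤ harm g - harm i := by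
  have := Real.strictMono_eulerMascheroniSeq.monotone h
  simp only [Real.eulerMascheroniSeq] at this
  rw [harm_eq, harm_eq]
  linarith

theorem sqrt_add_le_sqrt_add_sqrt {x y : ℝ} (hx : 0 ≤ x) (hy : 0 ≤ y) : √(x + y) ≤ √x + √y := by
  rw [Real.sqrt_le_iff]
  have h1 := Real.sqrt_nonneg x
  have h2 := Real.sqrt_nonneg y
  refine ⟨by positivity, ?_⟩
  rw [add_sq, Real.sq_sqrt hx, Real.sq_sqrt hy]
  nlinarith [mul_nonneg h1 h2]

theorem summable_record_error :
    Summable fun j : ℕ => 3 * (1 / ((j : ℝ) + 1)) ^ 2 * (1 + √((j : ℝ) + 1)) := by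
  have hs : Summable fun j : ℕ => 6 * (1 / ((j + 1 : ℕ) : ℝ) ^ (3 / 2 : ℝ)) :=
    ((summable_nat_add_iff 1).2 (Real.summable_one_div_nat_rpow.2 (by norm_num))).mul_left 6
  refine Summable.of_nonneg_of_le (fun _ => by positivity) (fun j => ?_) hs
  push_cast
  set x : ℝ := (j : ℝ) + 1
  have hx : 1 ≤ x := by simp [x]
  have h1 : x ^ (3 / 2 : ℝ) = x * √x := by
    rw [Real.sqrt_eq_rpow, ← Real.rpow_one_add' (by positivity) (by norm_num)]
    norm_num
  have h2 : 1 ≤ √x := Real.one_le_sqrt.2 hx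
  have h3 : √x * √x = x := Real.mul_self_sqrt (by positivity)
  rw [h1]
  have h4 : 6 * (1 / (x * √x)) = 3 * (1 / x) ^ 2 * (2 * √x) := by
    have hx0 : x ≠ 0 := by positivity
    have : √x ≠ 0 := by positivity
    field_simp
    nlinarith
  rw [h4]
  gcongr
  linarith

/-- The constant in the Poisson approximation of the number of records. -/
noncomputable def recordConst : ℝ :=
  ∑' j : ℕ, 3 * (1 / ((j : ℝ) + 1)) ^ 2 * (1 + √((j : ℝ) + 1))

theorem recordConst_nonneg : 0 ≤ recordConst := tsum_nonneg fun _ => by positivity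

theorem abs_recordOp_poissonOp_sub_le' {f : ℕ → ℝ} (hf : ∀ j, |f (j + 1) - f j| ≤ 1) (g : ℕ)
    {ν : ℝ} (hν : 0 ≤ ν) (k : ℕ) :
    |recordOp g (poissonOp ν f) k - poissonOp (ν + harm g) f k| ≤
      recordConst / (1 + √(Real.log (g + 1))) := by
  refine (abs_recordOp_poissonOp_sub_le hf g hν k).trans ?_
  rw [le_div_iff₀ (by positivity), Finset.sum_mul]
  refine (Finset.sum_le_sum fun j hj => ?_).trans
    (summable_record_error.sum_le_tsum (range g) fun _ _ => by positivity)
  have hjg : j + 1 ≤ g := Finset.mem_range.1 hj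
  set μ := ν + harm g - harm (j + 1) with hμ
  have hμ0 : 0 ≤ μ := by have := harm_mono hjg; linarith
  rw [div_mul_eq_mul_div, mul_div_assoc]
  gcongr
  rw [div_le_iff₀ (by positivity)]
  have h1 : Real.log (g + 1) ≤ μ + ((j : ℝ) + 1) := by
    have h2 := log_sub_log_le_harm_sub hjg
    have h3 := Real.log_le_sub_one_of_pos (show (0 : ℝ) < ((j + 1 : ℕ) : ℝ) + 1 by positivity)
    push_cast at h2 h3
    linarith
  have h4 : √(Real.log (g + 1)) ≤ √μ + √((j : ℝ) + 1) :=
    (Real.sqrt_le_sqrt h1).trans (sqrt_add_le_sqrt_add_sqrt hμ0 (by positivity))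
  nlinarith [Real.sqrt_nonneg μ, Real.sqrt_nonneg ((j : ℝ) + 1)]

theorem poissonOp_zero (f : ℕ → ℝ) : poissonOp 0 f = f := by
  funext k
  rw [poissonOp, egf, tsum_eq_single 0]
  · simp
  · intro j hj; simp [hj]

theorem abs_recordOp_recordOp_sub_le {f : ℕ → ℝ} (hf : ∀ j, |f (j + 1) - f j| ≤ 1) (g h : ℕ) :
    |recordOp g (recordOp h f) 0 - poissonOp (harm g + harm h) f 0| ≤
      recordConst / (1 + √(Real.log (g + 1))) + recordConst / (1 + √(Real.log (h + 1))) := by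
  have h1 (k : ℕ) : |recordOp h f k - poissonOp (harm h) f k| ≤
      recordConst / (1 + √(Real.log (h + 1))) := by
    simpa [poissonOp_zero] using abs_recordOp_poissonOp_sub_le' hf h le_rfl k
  have h2 := abs_recordOp_sub_le g h1 0
  have h3 := abs_recordOp_poissonOp_sub_le' hf g (harm_nonneg h) 0
  rw [add_comm (harm h)] at h3
  rw [add_comm (recordConst / _)]
  exact (abs_sub_le _ _ _).trans (add_le_add h2 h3)

/-- `binomialExp a u φ` is the expectation of `φ` under the binomial distribution with
parameters `a` and `u`. -/
noncomputable def binomialExp : ℕ → ℝ → (ℕ → ℝ) → ℝ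
  | 0, _, φ => φ 0
  | a + 1, u, φ => (1 - u) * binomialExp a u φ + u * binomialExp a u fun g => φ (g + 1)

theorem binomialExp_add (a : ℕ) (u : ℝ) (φ ψ : ℕ → ℝ) :
    binomialExp a u (fun g => φ g + ψ g) = binomialExp a u φ + binomialExp a u ψ := by
  induction a generalizing φ ψ with
  | zero => rfl
  | succ a ih => simp only [binomialExp, ih]; ring

theorem binomialExp_const_mul (a : ℕ) (u c : ℝ) (φ : ℕ → ℝ) :
    binomialExp a u (fun g => c * φ g) = c * binomialExp a u φ := by
  induction a generalizing φ with
  | zero => rfl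
  | succ a ih => simp only [binomialExp, ih]; ring

theorem binomialExp_sub (a : ℕ) (u : ℝ) (φ ψ : ℕ → ℝ) :
    binomialExp a u (fun g => φ g - ψ g) = binomialExp a u φ - binomialExp a u ψ := by
  induction a generalizing φ ψ with
  | zero => rfl
  | succ a ih => simp only [binomialExp, ih]; ring

theorem binomialExp_const (a : ℕ) (u c : ℝ) : binomialExp a u (fun _ => c) = c := by
  induction a with
  | zero => rfl
  | succ a ih => simp only [binomialExp, ih]; ring

theorem binomialExp_mono {a : ℕ} {u : ℝ} (hu : u ∈ Set.Icc (0 : ℝ) 1) {φ ψ : ℕ → ℝ}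
    (h : ∀ g ≤ a, φ g ≤ ψ g) : binomialExp a u φ ≤ binomialExp a u ψ := by
  induction a generalizing φ ψ with
  | zero => exact h 0 le_rfl
  | succ a ih =>
    have h1 := ih fun g hg => h g (by omega)
    have h2 := ih fun g hg => h (g + 1) (by omega)
    have h3 : 0 ≤ 1 - u := by linarith [hu.2]
    simp only [binomialExp]
    gcongr
    exact hu.1

theorem abs_binomialExp_le {a : ℕ} {u : ℝ} (hu : u ∈ Set.Icc (0 : ℝ) 1) {φ ψ : ℕ → ℝ}
    (h : ∀ g ≤ a, |φ g| ≤ ψ g) : |binomialExp a u φ| ≤ binomialExp a u ψ := by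
  rw [abs_le]
  constructor
  · have := binomialExp_mono hu fun g hg => (abs_le.1 (h g hg)).1
    rwa [show (fun g => -ψ g) = fun g => (-1) * ψ g by simp, binomialExp_const_mul,
      neg_one_mul] at this
  · exact binomialExp_mono hu fun g hg => (abs_le.1 (h g hg)).2

theorem binomialExp_id (a : ℕ) (u : ℝ) : binomialExp a u (fun g => (g : ℝ)) = a * u := by
  induction a with
  | zero => simp [binomialExp]
  | succ a ih =>
    simp only [binomialExp]
    push_cast
    rw [binomialExp_add, binomialExp_const, ih]
    ring

theorem binomialExp_size_bias (a : ℕ) (u : ℝ) (φ : ℕ → ℝ) :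
    binomialExp (a + 1) u (fun g => g * φ g) =
      ((a : ℝ) + 1) * u * binomialExp a u fun g => φ (g + 1) := by
  induction a generalizing φ with
  | zero => simp [binomialExp]
  | succ a ih =>
    rw [binomialExp, ih]
    have : binomialExp (a + 1) u (fun g => ((g + 1 : ℕ) : ℝ) * φ (g + 1)) =
        ((a : ℝ) + 1) * u * binomialExp a u (fun g => φ (g + 1 + 1)) +
          binomialExp (a + 1) u (fun g => φ (g + 1)) := by
      rw [← ih fun g => φ (g + 1), ← binomialExp_add]
      congr 1; funext g; push_cast; ring
    rw [this]
    simp only [binomialExp]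
    push_cast
    ring

theorem binomialExp_inv_succ_le (a : ℕ) {u : ℝ} (hu : u ∈ Set.Ioc (0 : ℝ) 1) :
    binomialExp a u (fun g => 1 / ((g : ℝ) + 1)) ≤ 1 / (((a : ℝ) + 1) * u) := by
  have h1 := binomialExp_size_bias a u fun g => 1 / (g : ℝ)
  have h2 : binomialExp (a + 1) u (fun g => (g : ℝ) * (1 / (g : ℝ))) ≤ 1 := by
    refine (binomialExp_mono ⟨hu.1.le, hu.2⟩ (ψ := fun _ => 1) fun g _ => ?_).trans_eq
      (binomialExp_const _ _ _)
    rw [mul_one_div]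
    exact div_self_le_one _
  rw [h1] at h2
  push_cast at h2
  have := hu.1
  rw [le_div_iff₀ (by positivity), mul_comm]
  exact h2

theorem sqrt_le_amgm {x c : ℝ} (hx : 0 ≤ x) (hc : 0 < c) : √x ≤ c / 2 * x + 1 / (2 * c) := by
  have h := Real.sq_sqrt hx
  have : c / 2 * x + 1 / (2 * c) - √x = (c * √x - 1) ^ 2 / (2 * c) := by
    field_simp
    nlinarith
  have h2 : 0 ≤ (c * √x - 1) ^ 2 / (2 * c) := by positivity
  linarith

theorem binomialExp_record_error_le (a : ℕ) {u : ℝ} (hu : u ∈ Set.Ioc (0 : ℝ) 1) :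
    binomialExp a u (fun g => recordConst / (1 + √(Real.log (g + 1)))) ≤
      2 * recordConst / √u / (1 + √(Real.log (a + 1))) := by
  have hu0 := hu.1
  have hsu : 0 < √u := Real.sqrt_pos.2 hu0
  have hsu1 : √u ≤ 1 := Real.sqrt_le_one.2 hu.2
  have hssu : √u * √u = u := Real.mul_self_sqrt hu0.le
  set L := Real.log ((a : ℝ) + 1) with hL
  have hK := recordConst_nonneg
  have hpt (g : ℕ) (hg : g ≤ a) : recordConst / (1 + √(Real.log (g + 1))) ≤
      recordConst / (1 + √L) * (√u / 2 * (((a : ℝ) + 1) * (1 / ((g : ℝ) + 1))) +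
        (1 / (2 * √u) + 1)) := by
    have hgR : (0 : ℝ) < (g : ℝ) + 1 := by positivity
    have hle : (g : ℝ) + 1 ≤ a + 1 := by gcongr
    set y : ℝ := ((a : ℝ) + 1) * (1 / ((g : ℝ) + 1)) with hy
    have hy1 : 1 ≤ y := by
      rw [hy, mul_one_div, one_le_div hgR]; exact hle
    have hlog : L = Real.log (g + 1) + Real.log y := by
      rw [← Real.log_mul (by positivity) (by positivity), hy]
      rw [hL]; congr 1; field_simp
    have h0 : 0 ≤ Real.log ((g : ℝ) + 1) := Real.log_nonneg (by simp)
    have h1 : √L ≤ √(Real.log (g + 1)) + √y := by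
      rw [hlog]
      refine (sqrt_add_le_sqrt_add_sqrt h0 (Real.log_nonneg hy1)).trans ?_
      gcongr
      exact Real.log_le_self (zero_le_one.trans hy1)
    have h2 := sqrt_le_amgm (zero_le_one.trans hy1) hsu
    rw [div_mul_eq_mul_div, div_le_div_iff₀ (by positivity) (by positivity), mul_assoc]
    gcongr
    have h3 : 1 + √L ≤ (1 + √y) * (1 + √(Real.log (g + 1))) := by
      nlinarith [Real.sqrt_nonneg y, Real.sqrt_nonneg (Real.log ((g : ℝ) + 1))]
    refine h3.trans (mul_le_mul_of_nonneg_right (by linarith) (by positivity))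
  refine (binomialExp_mono ⟨hu0.le, hu.2⟩ hpt).trans ?_
  rw [binomialExp_const_mul, binomialExp_add, binomialExp_const, binomialExp_const_mul,
    binomialExp_const_mul]
  have h4 := binomialExp_inv_succ_le a hu
  have h5 : ((a : ℝ) + 1) * binomialExp a u (fun g => 1 / ((g : ℝ) + 1)) ≤ 1 / u := by
    calc _ ≤ ((a : ℝ) + 1) * (1 / (((a : ℝ) + 1) * u)) := by gcongr
      _ = 1 / u := by field_simp
  have h6 : √u / 2 * (1 / u) + (1 / (2 * √u) + 1) ≤ 2 / √u := by
    have e1 : √u / 2 * (1 / u) = 1 / (2 * √u) := by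
      nth_rw 2 [← hssu]; field_simp
    have e2 : 1 ≤ 1 / √u := by rw [one_le_div hsu]; exact hsu1
    have e3 : 1 / (2 * √u) + 1 / (2 * √u) = 1 / √u := by field_simp; norm_num
    have e4 : 2 / √u = 1 / √u + 1 / √u := by ring
    linarith
  calc _ ≤ recordConst / (1 + √L) * (√u / 2 * (1 / u) + (1 / (2 * √u) + 1)) := by gcongr
    _ ≤ recordConst / (1 + √L) * (2 / √u) := by gcongr
    _ = _ := by ring

theorem abs_log_le {x c : ℝ} (hx : 0 < x) (hc : 0 < c) :
    |Real.log x| ≤ c / 2 * (x + 1 / x - 2) + 1 / (2 * c) := by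
  have h1 : |Real.log x| ≤ √(x + 1 / x - 2) := by
    refine Real.le_sqrt_of_sq_le ?_
    rw [sq_abs]
    have h2 : |Real.log x / 2| ≤ |Real.sinh (Real.log x / 2)| := by
      rw [Real.abs_sinh]
      exact Real.self_le_sinh_iff.2 (abs_nonneg _)
    have h3 := Real.cosh_two_mul (Real.log x / 2)
    have h4 := Real.cosh_sq (Real.log x / 2)
    rw [mul_div_cancel₀ _ two_ne_zero, Real.cosh_log hx] at h3
    have h5 := sq_le_sq.2 h2
    rw [one_div]
    nlinarith
  refine h1.trans (sqrt_le_amgm ?_ hc)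
  have : x + 1 / x - 2 = (x - 1) ^ 2 / x := by field_simp; ring
  rw [this]; positivity

theorem abs_harm_sub_le (g : ℕ) :
    |harm g - Real.eulerMascheroniConstant - Real.log (g + 1)| ≤ 1 / ((g : ℝ) + 1) := by
  have h1 := (Real.eulerMascheroniSeq_lt_eulerMascheroniConstant g).le
  have h2 := (Real.eulerMascheroniConstant_lt_eulerMascheroniSeq' (g + 1)).le
  simp only [Real.eulerMascheroniSeq, Real.eulerMascheroniSeq', Nat.succ_ne_zero, if_false,
    ← harm_eq, harm_succ] at h1 h2
  push_cast at h2
  rw [abs_le]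
  constructor <;> linarith

theorem binomialExp_harm_le (a : ℕ) {u : ℝ} (hu : u ∈ Set.Ioc (0 : ℝ) 1) :
    binomialExp a u (fun g => |harm g -
      (Real.eulerMascheroniConstant + Real.log (((a : ℝ) + 1) * u))|) ≤
      2 / √(((a : ℝ) + 1) * u) := by
  have hu0 := hu.1
  have hu' : u ∈ Set.Icc (0 : ℝ) 1 := ⟨hu0.le, hu.2⟩
  set M := ((a : ℝ) + 1) * u with hM
  have hM0 : 0 < M := by positivity
  have hs : 0 < √M := Real.sqrt_pos.2 hM0
  have hss : √M * √M = M := Real.mul_self_sqrt hM0.le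
  have hinv := binomialExp_inv_succ_le a hu
  have hinv1 : binomialExp a u (fun g => 1 / ((g : ℝ) + 1)) ≤ 1 := by
    refine (binomialExp_mono hu' (ψ := fun _ => 1) fun g _ => ?_).trans_eq
      (binomialExp_const _ _ _)
    rw [div_le_one (by positivity)]; linarith [(Nat.cast_nonneg g : (0 : ℝ) ≤ g)]
  have hpt (g : ℕ) (_ : g ≤ a) :
      |harm g - (Real.eulerMascheroniConstant + Real.log M)| ≤
        (√M / 2 / M) * g + ((1 + √M / 2 * M) * (1 / ((g : ℝ) + 1)) +
          (√M / 2 / M - √M + 1 / (2 * √M))) := by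
    have h1 := abs_harm_sub_le g
    have h2 := abs_log_le (x := ((g : ℝ) + 1) / M) (by positivity) hs
    rw [Real.log_div (by positivity) hM0.ne'] at h2
    have h3 : harm g - (Real.eulerMascheroniConstant + Real.log M) =
      (harm g - Real.eulerMascheroniConstant - Real.log (g + 1)) +
        (Real.log (g + 1) - Real.log M) := by ring
    rw [h3]
    refine (abs_add_le _ _).trans ((add_le_add h1 h2).trans_eq ?_)
    field_simp
    ring
  refine (binomialExp_mono hu' hpt).trans ?_
  rw [binomialExp_add, binomialExp_add, binomialExp_const, binomialExp_const_mul,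
    binomialExp_const_mul, binomialExp_id]
  set I := binomialExp a u fun g => 1 / ((g : ℝ) + 1)
  have hI : I ≤ 1 / √M := by
    rcases le_total 1 M with h | h
    · refine hinv.trans (one_div_le_one_div_of_le hs ?_)
      have : 1 ≤ √M := Real.one_le_sqrt.2 h
      nlinarith
    · refine hinv1.trans ?_
      rw [one_le_div hs]
      exact Real.sqrt_le_one.2 h
  have h5 : √M / 2 * M * I ≤ √M / 2 := by
    calc √M / 2 * M * I ≤ √M / 2 * M * (1 / M) := by gcongr
      _ = √M / 2 := by field_simp
  have h6 : √M / 2 / M * (a * u) + √M / 2 / M ≤ √M / 2 + 1 / (2 * √M) := by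
    have e1 : √M / 2 / M = 1 / (2 * √M) := by nth_rw 2 [← hss]; field_simp
    have e2 : √M / 2 = 1 / (2 * √M) * M := by nth_rw 3 [← hss]; field_simp
    have e3 : (a : ℝ) * u = M - u := by rw [hM]; ring
    rw [e1, e3, e2]
    have : 0 ≤ 1 / (2 * √M) * u := by positivity
    nlinarith
  have e4 : 2 / √M = 1 / √M + 1 / (2 * √M) + 1 / (2 * √M) := by field_simp; norm_num
  nlinarith

theorem hasDerivAt_binomialExp (a : ℕ) {u : ℝ} {ψ : ℕ → ℝ → ℝ} {ψ' : ℕ → ℝ}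
    (h : ∀ g, HasDerivAt (ψ g) (ψ' g) u) :
    HasDerivAt (fun v => binomialExp a v fun g => ψ g v)
      (a * binomialExp (a - 1) u (fun g => ψ (g + 1) u - ψ g u) + binomialExp a u ψ') u := by
  induction a generalizing ψ ψ' with
  | zero => simpa [binomialExp] using h 0
  | succ a ih =>
    have h1 := ((hasDerivAt_id u).const_sub 1).mul (ih h)
    have h2 := (hasDerivAt_id u).mul (ih fun g => h (g + 1))
    refine (h1.add h2).congr_deriv ?_
    have h3 : (a : ℝ) * ((1 - u) * binomialExp (a - 1) u (fun g => ψ (g + 1) u - ψ g u) +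
        u * binomialExp (a - 1) u (fun g => ψ (g + 1 + 1) u - ψ (g + 1) u)) =
        a * binomialExp a u (fun g => ψ (g + 1) u - ψ g u) := by
      rcases a with _ | a
      · simp
      · rw [Nat.add_sub_cancel, ← binomialExp]
    rw [Nat.add_sub_cancel]
    have h4 := binomialExp_sub a u (fun g => ψ (g + 1) u) fun g => ψ g u
    simp only [id, binomialExp]
    push_cast
    linear_combination h3 - h4

theorem mul_binomialExp_diff (a : ℕ) (u : ℝ) (φ : ℕ → ℝ) :
    u * (a * binomialExp (a - 1) u fun g => φ (g + 1) - φ g) =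
      a * (binomialExp a u φ - binomialExp (a - 1) u φ) := by
  rcases a with _ | a
  · simp
  · rw [Nat.add_sub_cancel, binomialExp_sub, binomialExp]
    ring

/-- The expectation of `Ψ` under independent binomial distributions with a common success
probability `u`. -/
noncomputable def binomialExp₂ (a b : ℕ) (u : ℝ) (Ψ : ℕ → ℕ → ℝ) : ℝ :=
  binomialExp a u fun g => binomialExp b u (Ψ g)

theorem exists_hasDerivAt_binomialExp₂ (a b : ℕ) (u : ℝ) (Ψ : ℕ → ℕ → ℝ) :
    ∃ Q', HasDerivAt (fun v => binomialExp₂ a b v Ψ) Q' u ∧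
      u * Q' = (a + b) * binomialExp₂ a b u Ψ - a * binomialExp₂ (a - 1) b u Ψ -
        b * binomialExp₂ a (b - 1) u Ψ := by
  have h (g : ℕ) := hasDerivAt_binomialExp b (u := u) (ψ := fun h _ => Ψ g h) (ψ' := fun _ => 0)
    fun _ => hasDerivAt_const _ _
  refine ⟨_, hasDerivAt_binomialExp a h, ?_⟩
  rw [mul_add, mul_binomialExp_diff a u fun g => binomialExp b u (Ψ g), ← binomialExp_const_mul]
  have h2 (g : ℕ) := mul_binomialExp_diff b u (Ψ g)
  simp only [binomialExp_const, add_zero, h2]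
  rw [binomialExp_const_mul, binomialExp_sub]
  simp only [binomialExp₂]
  ring

theorem continuous_binomialExp₂ (a b : ℕ) (Ψ : ℕ → ℕ → ℝ) :
    Continuous fun u => binomialExp₂ a b u Ψ :=
  continuous_iff_continuousAt.2 fun u =>
    (exists_hasDerivAt_binomialExp₂ a b u Ψ).choose_spec.1.continuousAt

theorem binomialExp_one (a : ℕ) (φ : ℕ → ℝ) : binomialExp a 1 φ = φ a := by
  induction a generalizing φ with
  | zero => rfl
  | succ a ih => simp [binomialExp, ih]

theorem integrableOn_exp_neg_mul {q : ℝ → ℝ} (hq : Continuous q) :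
    IntegrableOn (fun x => Real.exp (-x) * q (Real.exp (-x))) (Set.Ioi 0) := by
  obtain ⟨C, hC⟩ := (isCompact_Icc (a := (0 : ℝ)) (b := 1)).exists_bound_of_continuousOn
    hq.continuousOn
  have h := exp_neg_integrableOn_Ioi 0 one_pos
  simp only [neg_mul, one_mul] at h
  refine Integrable.mul_bdd (c := C) h (by fun_prop) ?_
  filter_upwards [ae_restrict_mem measurableSet_Ioi] with x hx
  refine hC _ ⟨(Real.exp_pos _).le, Real.exp_le_one_iff.2 ?_⟩
  linarith [Set.mem_Ioi.1 hx]

theorem integral_binomialExp₂_rec (a b : ℕ) (Ψ : ℕ → ℕ → ℝ) :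
    ((a : ℝ) + b + 1) * ∫ x in Set.Ioi (0 : ℝ),
        Real.exp (-x) * binomialExp₂ a b (Real.exp (-x)) Ψ =
      a * (∫ x in Set.Ioi (0 : ℝ), Real.exp (-x) * binomialExp₂ (a - 1) b (Real.exp (-x)) Ψ) +
      b * (∫ x in Set.Ioi (0 : ℝ), Real.exp (-x) * binomialExp₂ a (b - 1) (Real.exp (-x)) Ψ) +
      Ψ a b := by
  have hi (c d : ℕ) := integrableOn_exp_neg_mul (continuous_binomialExp₂ c d Ψ)
  have hd (x : ℝ) : HasDerivAt
      (fun x => -(Real.exp (-x) * binomialExp₂ a b (Real.exp (-x)) Ψ))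
      (((a : ℝ) + b + 1) * (Real.exp (-x) * binomialExp₂ a b (Real.exp (-x)) Ψ) -
        a * (Real.exp (-x) * binomialExp₂ (a - 1) b (Real.exp (-x)) Ψ) -
        b * (Real.exp (-x) * binomialExp₂ a (b - 1) (Real.exp (-x)) Ψ)) x := by
    obtain ⟨Q', h1, h2⟩ := exists_hasDerivAt_binomialExp₂ a b (Real.exp (-x)) Ψ
    have he : HasDerivAt (fun x => Real.exp (-x)) (-Real.exp (-x)) x :=
      ((hasDerivAt_neg x).exp).congr_deriv (by ring)
    refine (he.mul (h1.comp x he)).neg.congr_deriv ?_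
    simp only [Function.comp_apply]
    linear_combination Real.exp (-x) * h2
  have ht : Tendsto (fun x => -(Real.exp (-x) * binomialExp₂ a b (Real.exp (-x)) Ψ)) atTop
      (nhds 0) := by
    have h0 : Tendsto (fun x => Real.exp (-x)) atTop (nhds 0) := Real.tendsto_exp_neg_atTop_nhds_zero
    simpa using (h0.mul (((continuous_binomialExp₂ a b Ψ).tendsto 0).comp h0)).neg
  have i1 := (hi a b).const_mul ((a : ℝ) + b + 1)
  have i2 := (hi (a - 1) b).const_mul (a : ℝ)
  have i3 := (hi a (b - 1)).const_mul (b : ℝ)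
  have hF := integral_Ioi_of_hasDerivAt_of_tendsto' (a := 0) (fun x _ => hd x)
    ((i1.sub i2).sub i3) ht
  have e := integral_sub (i1.sub i2) i3
  have e' := integral_sub i1 i2
  simp only [Pi.sub_apply, integral_const_mul] at e e'
  rw [e, e'] at hF
  simp only [neg_zero, Real.exp_zero, binomialExp₂, binomialExp_one] at hF
  simp only [binomialExp₂]
  linarith

theorem depthMean_eq_integral (a b : ℕ) (F : ℕ → ℝ) :
    depthMean a b F = ∫ x in Set.Ioi (0 : ℝ), Real.exp (-x) *
      binomialExp₂ a b (Real.exp (-x)) fun g h => recordOp g (recordOp h F) 0 := by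
  induction hn : a + b generalizing a b with
  | zero =>
    obtain ⟨rfl, rfl⟩ : a = 0 ∧ b = 0 := by omega
    have h1 := depthMean_rec 0 0 F
    have h2 := integral_binomialExp₂_rec 0 0 fun g h => recordOp g (recordOp h F) 0
    simp only [Nat.cast_zero, zero_mul, zero_add, one_mul] at h1 h2
    rw [h1, h2]
  | succ n ih =>
    have h1 := depthMean_rec a b F
    have h2 := integral_binomialExp₂_rec a b fun g h => recordOp g (recordOp h F) 0
    have e1 : (a : ℝ) * depthMean (a - 1) b F = a * ∫ x in Set.Ioi (0 : ℝ), Real.exp (-x) *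
        binomialExp₂ (a - 1) b (Real.exp (-x)) fun g h => recordOp g (recordOp h F) 0 := by
      rcases a with _ | a
      · simp
      · rw [ih _ _ (by omega)]
    have e2 : (b : ℝ) * depthMean a (b - 1) F = b * ∫ x in Set.Ioi (0 : ℝ), Real.exp (-x) *
        binomialExp₂ a (b - 1) (Real.exp (-x)) fun g h => recordOp g (recordOp h F) 0 := by
      rcases b with _ | b
      · simp
      · rw [ih _ _ (by omega)]
    have hpos : (a : ℝ) + b + 1 ≠ 0 := by positivity
    rw [e1, e2, ← h2] at h1
    exact mul_left_cancel₀ hpos h1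

theorem measurable_gammaPDF_one : Measurable (gammaPDF 1 1) :=
  (measurable_gammaPDFReal 1 1).ennreal_ofReal

theorem integral_expMeasure_one (φ : ℝ → ℝ) :
    ∫ x, φ x ∂expMeasure 1 = ∫ x in Set.Ioi (0 : ℝ), Real.exp (-x) * φ x := by
  rw [expMeasure, gammaMeasure, integral_withDensity_eq_integral_toReal_smul
    measurable_gammaPDF_one (ae_of_all _ fun _ => ENNReal.ofReal_lt_top),
    ← integral_Ici_eq_integral_Ioi, ← integral_indicator measurableSet_Ici]
  refine integral_congr_ae (ae_of_all _ fun x => ?_)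
  simp only [gammaPDF, ENNReal.toReal_ofReal (gammaPDFReal_nonneg one_pos one_pos x), smul_eq_mul]
  by_cases hx : 0 ≤ x <;> simp [gammaPDFReal, hx, Set.indicator]

theorem ae_expMeasure_one_nonneg : ∀ᵐ x ∂expMeasure 1, 0 ≤ x := by
  rw [expMeasure, gammaMeasure, ae_withDensity_iff measurable_gammaPDF_one]
  refine ae_of_all _ fun x hx => ?_
  by_contra h
  exact hx (gammaPDF_of_neg (not_le.1 h))

theorem integral_mixPo {ρ : Measure ℝ} [IsProbabilityMeasure ρ] {lam : ℝ → ℝ} {c : ℝ}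
    (hm : Measurable lam) (hb : ∀ᵐ x ∂ρ, lam x ∈ Set.Icc 0 c) {f : ℝ → ℝ} (hf : Measurable f)
    (hfb : GeomBounded fun k => f k) :
    ∫ x, f x ∂(Measure.map (Nat.cast : ℕ → ℝ) (mixPo (Measure.map lam ρ))) =
      ∫ x, poissonOp (lam x) (fun k => f k) 0 ∂ρ := by
  have hle (k : ℕ) : ∀ᵐ x ∂ρ, ‖Real.exp (-lam x) * lam x ^ k / k.factorial‖ ≤
      c ^ k / k.factorial := by
    filter_upwards [hb] with x hx
    have h0 : 0 ≤ lam x ^ k := pow_nonneg hx.1 _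
    rw [Real.norm_of_nonneg (by positivity)]
    gcongr
    calc _ ≤ 1 * lam x ^ k := by
          gcongr; exact Real.exp_le_one_iff.2 (by linarith [hx.1])
      _ ≤ c ^ k := by rw [one_mul]; exact pow_le_pow_left₀ hx.1 hx.2 k
  have hintg (k : ℕ) : Integrable (fun x => Real.exp (-lam x) * lam x ^ k / k.factorial) ρ :=
    Integrable.of_bound (by fun_prop) _ (hle k)
  have hcoef (k : ℕ) : (∫⁻ l, ENNReal.ofReal (Real.exp (-l) * l ^ k / k.factorial)
      ∂(Measure.map lam ρ)) =
      ENNReal.ofReal (∫ x, Real.exp (-lam x) * lam x ^ k / k.factorial ∂ρ) := by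
    rw [lintegral_map (by fun_prop) hm, ofReal_integral_eq_lintegral_ofReal (hintg k)]
    filter_upwards [hb] with x hx
    have h0 : 0 ≤ lam x ^ k := pow_nonneg hx.1 _
    simp only [Pi.zero_apply]
    positivity
  have hpos (k : ℕ) : 0 ≤ ∫ x, Real.exp (-lam x) * lam x ^ k / k.factorial ∂ρ := by
    refine integral_nonneg_of_ae ?_
    filter_upwards [hb] with x hx
    have h0 : 0 ≤ lam x ^ k := pow_nonneg hx.1 _
    simp only [Pi.zero_apply]
    positivity
  rw [integral_map (measurable_of_countable _).aemeasurable hf.aestronglyMeasurable, mixPo,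
    integral_sum_dirac fun k => by rw [hcoef]; exact ENNReal.ofReal_ne_top]
  have hsum : Summable fun k : ℕ =>
      ∫ x, ‖Real.exp (-lam x) * lam x ^ k / k.factorial * f k‖ ∂ρ := by
    refine Summable.of_nonneg_of_le (fun k => integral_nonneg fun _ => norm_nonneg _) (fun k => ?_)
      (hfb.summable_norm c).abs
    calc _ ≤ ∫ _, |c ^ k / k.factorial * ‖f k‖| ∂ρ := by
          refine integral_mono_ae ((hintg k).mul_const _).norm (integrable_const _) ?_
          filter_upwards [hle k] with x hx
          rw [norm_mul]
          refine le_trans ?_ (le_abs_self _)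
          exact mul_le_mul_of_nonneg_right hx (norm_nonneg _)
      _ = |c ^ k / k.factorial * ‖f k‖| := by simp
      _ ≤ _ := by simp [abs_mul, abs_div]
  have h := (hasSum_integral_of_summable_integral_norm (fun k => (hintg k).mul_const _) hsum).tsum_eq
  simp only [hcoef, ENNReal.toReal_ofReal (hpos _), smul_eq_mul]
  simp only [integral_mul_const] at h
  rw [h]
  congr with x
  rw [poissonOp, egf, ← tsum_mul_left]
  congr with k
  rw [zero_add]
  ring

theorem integral_bstDepth (a b : ℕ) (F : ℝ → ℝ) (hF : Measurable F) :
    ∫ x, F x ∂(Measure.map (fun π => (bstDepth (a + b + 1) (a + 1) π : ℝ))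
      (uniformPerm (a + b + 1))) = depthMean a b fun k => F k := by
  have : MeasurableSingletonClass (Equiv.Perm (Fin (a + b + 1))) := ⟨fun _ => trivial⟩
  rw [integral_map (measurable_of_countable _).aemeasurable hF.aestronglyMeasurable, uniformPerm,
    PMF.integral_eq_sum, depthMean, Finset.sum_div]
  refine Finset.sum_congr rfl fun π _ => ?_
  simp [Fintype.card_perm, div_eq_inv_mul]

/-- The contribution of one side of the tree with `a` keys to the approximation error. -/
noncomputable def sideError (a : ℕ) : ℝ :=
  2 * recordConst / (1 + √(Real.log (a + 1))) + 2 / √((a : ℝ) + 1)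

theorem sideError_nonneg (a : ℕ) : 0 ≤ sideError a := by
  have := recordConst_nonneg
  unfold sideError
  positivity

theorem binomialExp_sideError_le (a : ℕ) {u : ℝ} (hu : u ∈ Set.Ioc (0 : ℝ) 1) :
    binomialExp a u (fun g => recordConst / (1 + √(Real.log (g + 1))) +
      |harm g - (Real.eulerMascheroniConstant + Real.log (((a : ℝ) + 1) * u))|) ≤
      sideError a / √u := by
  rw [binomialExp_add]
  refine (add_le_add (binomialExp_record_error_le a hu) (binomialExp_harm_le a hu)).trans_eq ?_
  rw [sideError, Real.sqrt_mul (by positivity), add_div]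
  congr 1
  · rw [div_right_comm]
  · rw [div_mul_eq_div_div]

theorem abs_sub_max_zero_le {x y : ℝ} (hx : 0 ≤ x) : |x - max 0 y| ≤ |x - y| := by
  rcases le_total 0 y with h | h
  · rw [max_eq_right h]
  · rw [max_eq_left h, sub_zero, abs_of_nonneg hx, abs_of_nonneg (by linarith)]
    linarith

theorem abs_binomialExp₂_sub_poissonOp_le {f : ℕ → ℝ} (hf : ∀ j, |f (j + 1) - f j| ≤ 1)
    (a b : ℕ) {u : ℝ} (hu : u ∈ Set.Ioc (0 : ℝ) 1) (y : ℝ) :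
    |binomialExp₂ a b u (fun g h => recordOp g (recordOp h f) 0) - poissonOp (max 0 y) f 0| ≤
      (sideError a + sideError b) / √u +
        |Real.eulerMascheroniConstant + Real.log (((a : ℝ) + 1) * u) +
          (Real.eulerMascheroniConstant + Real.log (((b : ℝ) + 1) * u)) - y| := by
  have hu' : u ∈ Set.Icc (0 : ℝ) 1 := ⟨hu.1.le, hu.2⟩
  set s := Real.eulerMascheroniConstant + Real.log (((a : ℝ) + 1) * u)
  set t := Real.eulerMascheroniConstant + Real.log (((b : ℝ) + 1) * u)
  set D := |s + t - y|
  have hpt (g h : ℕ) :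
      |recordOp g (recordOp h f) 0 - poissonOp (max 0 y) f 0| ≤
        (recordConst / (1 + √(Real.log (g + 1))) + |harm g - s|) +
          (recordConst / (1 + √(Real.log (h + 1))) + |harm h - t|) + D := by
    have h1 := abs_recordOp_recordOp_sub_le hf g h
    have hpos := add_nonneg (harm_nonneg g) (harm_nonneg h)
    have h2 := (abs_poissonOp_sub_le_of_lip hf hpos (le_max_left 0 y) 0).trans
      (abs_sub_max_zero_le hpos)
    have h3 := abs_sub_le (recordOp g (recordOp h f) 0) (poissonOp (harm g + harm h) f 0)
      (poissonOp (max 0 y) f 0)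
    have h4 : |harm g + harm h - y| ≤ |harm g - s| + |harm h - t| + D := by
      rw [show harm g + harm h - y = (harm g - s) + (harm h - t) + (s + t - y) by ring]
      exact (abs_add_le _ _).trans (add_le_add_left (abs_add_le _ _) _)
    linarith
  have e : binomialExp₂ a b u (fun g h => recordOp g (recordOp h f) 0) - poissonOp (max 0 y) f 0 =
      binomialExp a u fun g => binomialExp b u fun h =>
        recordOp g (recordOp h f) 0 - poissonOp (max 0 y) f 0 := by
    simp only [binomialExp_sub, binomialExp_const, binomialExp₂]
  rw [e]
  refine (abs_binomialExp_le hu' fun g _ => abs_binomialExp_le hu' fun h _ => hpt g h).trans ?_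
  simp only [binomialExp_add b, binomialExp_const b]
  rw [binomialExp_add, binomialExp_const, binomialExp_add, binomialExp_const, add_div,
    ← binomialExp_add b]
  exact add_le_add_left (add_le_add (binomialExp_sideError_le a hu)
    (binomialExp_sideError_le b hu)) _

theorem dW_bstDepth_mixPo_le (a b : ℕ) (c : ℝ) :
    dW (Measure.map (fun π => (bstDepth (a + b + 1) (a + 1) π : ℝ)) (uniformPerm (a + b + 1)))
        (Measure.map (Nat.cast : ℕ → ℝ) (mixPo (Measure.map (fun x => max 0 (c - 2 * x))
          (expMeasure 1)))) ≤
      2 * (sideError a + sideError b + |2 * Real.eulerMascheroniConstant + Real.log (a + 1) +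
        Real.log (b + 1) - c|) := by
  set D := |2 * Real.eulerMascheroniConstant + Real.log (a + 1) + Real.log (b + 1) - c| with hD
  have hD0 : 0 ≤ D := abs_nonneg _
  have ha := sideError_nonneg a
  have hb := sideError_nonneg b
  refine Real.sSup_le ?_ (by positivity)
  rintro d ⟨f, hfm, hf, rfl⟩
  have hlip : ∀ j : ℕ, |f ((j + 1 : ℕ) : ℝ) - f (j : ℝ)| ≤ 1 := fun j => hf _ _ (by simp)
  have hgeom : GeomBounded fun k : ℕ => f k := geomBounded_of_lip hlip
  have := isProbabilityMeasure_expMeasure one_pos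
  rw [integral_bstDepth a b f hfm, integral_mixPo (c := max 0 c) (by fun_prop) ?_ hfm hgeom,
    integral_expMeasure_one, depthMean_eq_integral]
  swap
  · filter_upwards [ae_expMeasure_one_nonneg] with x hx
    exact ⟨le_max_left _ _, max_le_max le_rfl (by linarith)⟩
  have i1 := integrableOn_exp_neg_mul (continuous_binomialExp₂ a b
    fun g h => recordOp g (recordOp h fun k => f k) 0)
  have hcont : Continuous fun μ => poissonOp μ (fun k => f k) 0 :=
    continuous_iff_continuousAt.2 fun μ => (hasDerivAt_poissonOp hgeom 0 μ).continuousAt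
  have hexp : IntegrableOn (fun x => Real.exp (-x)) (Set.Ioi 0) := by
    simpa using exp_neg_integrableOn_Ioi 0 one_pos
  have i2 : IntegrableOn (fun x => Real.exp (-x) *
      poissonOp (max 0 (c - 2 * x)) (fun k => f k) 0) (Set.Ioi 0) := by
    refine Integrable.mul_bdd (c := max 0 c + |f 0|) hexp (by fun_prop) ?_
    filter_upwards [ae_restrict_mem measurableSet_Ioi] with x hx
    have h1 := abs_poissonOp_sub_le_of_lip (f := fun k => f k) hlip (le_max_left 0 (c - 2 * x)) le_rfl 0
    have h2 : max 0 (c - 2 * x) ≤ max 0 c :=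
      max_le_max le_rfl (by linarith [Set.mem_Ioi.1 hx])
    rw [poissonOp_zero, sub_zero, abs_of_nonneg (le_max_left 0 (c - 2 * x))] at h1
    have h3 := abs_sub_abs_le_abs_sub (poissonOp (max 0 (c - 2 * x)) (fun k => f k) 0)
      (f ((0 : ℕ) : ℝ))
    rw [Real.norm_eq_abs]
    rw [Nat.cast_zero] at h1 h3
    linarith
  rw [← integral_sub i1 i2, ← Real.norm_eq_abs]
  have hhalf : IntegrableOn (fun x : ℝ => Real.exp (-(1 / 2) * x)) (Set.Ioi 0) :=
    exp_neg_integrableOn_Ioi 0 one_half_pos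
  have hval : ∫ x in Set.Ioi (0 : ℝ), Real.exp (-(1 / 2) * x) = 2 := by
    rw [integral_exp_mul_Ioi (by norm_num)]
    norm_num
  refine (norm_integral_le_of_norm_le (hhalf.mul_const (sideError a + sideError b + D)) ?_).trans_eq
    (by rw [integral_mul_const, hval])
  filter_upwards [ae_restrict_mem measurableSet_Ioi] with x hx
  have hu : Real.exp (-x) ∈ Set.Ioc (0 : ℝ) 1 :=
    ⟨Real.exp_pos _, Real.exp_le_one_iff.2 (by linarith [Set.mem_Ioi.1 hx])⟩
  have hmain := abs_binomialExp₂_sub_poissonOp_le (f := fun k => f k) hlip a b hu (c - 2 * x)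
  rw [Real.log_mul (by positivity) hu.1.ne', Real.log_mul (by positivity) hu.1.ne',
    Real.log_exp, show Real.eulerMascheroniConstant + (Real.log (a + 1) + -x) +
      (Real.eulerMascheroniConstant + (Real.log (b + 1) + -x)) - (c - 2 * x) =
      2 * Real.eulerMascheroniConstant + Real.log (a + 1) + Real.log (b + 1) - c by ring,
    ← hD] at hmain
  have hsq : √(Real.exp (-x)) = Real.exp (-(1 / 2) * x) := by
    rw [Real.sqrt_eq_iff_mul_self_eq (Real.exp_pos _).le (Real.exp_pos _).le, ← Real.exp_add]
    ring_nf
  have hE : Real.exp (-x) = Real.exp (-(1 / 2) * x) * Real.exp (-(1 / 2) * x) := by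
    rw [← Real.exp_add]; ring_nf
  have hpos := Real.exp_pos (-(1 / 2) * x)
  have hle : Real.exp (-(1 / 2) * x) ≤ 1 :=
    Real.exp_le_one_iff.2 (by linarith [Set.mem_Ioi.1 hx])
  rw [← mul_sub, norm_mul, Real.norm_of_nonneg (Real.exp_pos _).le, Real.norm_eq_abs]
  refine (mul_le_mul_of_nonneg_left hmain (Real.exp_pos _).le).trans ?_
  rw [hsq, hE]
  set v := Real.exp (-(1 / 2) * x)
  calc v * v * ((sideError a + sideError b) / v + D)
      = v * (sideError a + sideError b) + v * (v * D) := by field_simp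
    _ ≤ v * (sideError a + sideError b) + v * D := by
        gcongr
        exact mul_le_of_le_one_left hD0 hle
    _ = v * (sideError a + sideError b + D) := by ring

theorem abs_log_sub_log_le {x s : ℝ} (hs : 0 < s) (h : |x - s| ≤ s / 2) :
    |Real.log x - Real.log s| ≤ 2 / s * |x - s| := by
  obtain ⟨h1, h2⟩ := abs_le.1 h
  have hx : 0 < x := by linarith
  have e1 := Real.log_le_sub_one_of_pos (div_pos hx hs)
  have e2 := Real.log_le_sub_one_of_pos (div_pos hs hx)
  rw [Real.log_div hx.ne' hs.ne', div_sub_one hs.ne'] at e1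
  rw [Real.log_div hs.ne' hx.ne', div_sub_one hx.ne'] at e2
  have h3 : (x - s) / s ≤ 2 / s * |x - s| := by
    rw [div_mul_eq_mul_div]
    gcongr
    linarith [le_abs_self (x - s), abs_nonneg (x - s)]
  have h4 : (s - x) / x ≤ 2 / s * |x - s| := by
    rw [div_mul_eq_mul_div, div_le_div_iff₀ hx hs]
    have := neg_le_abs (x - s)
    nlinarith [abs_nonneg (x - s)]
  rw [abs_le]
  constructor <;> linarith

theorem sideError_le {a : ℕ} {x : ℝ} (hx : 0 < x) (h : x / 4 ≤ Real.log (a + 1)) :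
    sideError a ≤ (4 * recordConst + 4) / √x := by
  have hr := recordConst_nonneg
  have hx' : 0 < √x := Real.sqrt_pos.2 hx
  have h1 : √x / 2 ≤ √(Real.log (a + 1)) := by
    refine Real.le_sqrt_of_sq_le ?_
    rw [div_pow, Real.sq_sqrt hx.le]
    linarith
  have h2 : √x / 2 ≤ √((a : ℝ) + 1) :=
    h1.trans (Real.sqrt_le_sqrt (Real.log_le_self (by positivity)))
  calc sideError a ≤ 2 * recordConst / (√x / 2) + 2 / (√x / 2) := by
        unfold sideError
        gcongr
        linarith
    _ = (4 * recordConst + 4) / √x := by field_simp; ring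

theorem side_bounds {a n : ℕ} {s c : ℝ} (hs : 0 < s) (hn : 0 < Real.log n)
    (hlog : -Real.log (s / 2) ≤ 3 / 4 * Real.log n)
    (h : |((a : ℝ) + 1) / n - s| ≤ c / √(Real.log n)) (hc : c / √(Real.log n) ≤ s / 2) :
    sideError a ≤ (4 * recordConst + 4) / √(Real.log n) ∧
      |Real.log (a + 1) - Real.log n - Real.log s| ≤ 2 / s * c / √(Real.log n) := by
  have hn0 : (0 : ℝ) < n := by
    rcases Nat.eq_zero_or_pos n with rfl | h0
    · simp at hn
    · exact_mod_cast h0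
  have hlogdiv : Real.log (((a : ℝ) + 1) / n) = Real.log (a + 1) - Real.log n :=
    Real.log_div (by positivity) hn0.ne'
  constructor
  · refine sideError_le hn ?_
    have h1 : s / 2 ≤ ((a : ℝ) + 1) / n := by linarith [(abs_le.1 (h.trans hc)).1]
    have h2 := Real.log_le_log (by positivity) h1
    linarith
  · rw [← hlogdiv, mul_div_assoc]
    exact (abs_log_sub_log_le hs (h.trans hc)).trans
      (mul_le_mul_of_nonneg_left h (by positivity))

theorem mixed_poisson_approximation_midrange (t : ℝ) (ht : t ∈ Set.Ioo (0 : ℝ) 1)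
    (l : ℕ → ℕ) (hl : ∀ n, 1 ≤ n → l n ∈ Finset.Icc 1 n)
    (hrate : ∃ C : ℝ, ∃ n₀ : ℕ, ∀ n ≥ n₀,
      |(l n : ℝ) / n - t| ≤ C / Real.sqrt (Real.log n)) :
    ∃ C : ℝ, ∃ n₀ : ℕ, ∀ n ≥ n₀,
      dW (Measure.map (fun π => (bstDepth n (l n) π : ℝ)) (uniformPerm n))
          (Measure.map (Nat.cast : ℕ → ℝ) (mixPo (Measure.map
            (fun x => max 0 (2 * Real.log n + 2 * Real.eulerMascheroniConstant
              + Real.log (t * (1 - t)) - 2 * x))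
            (ProbabilityTheory.expMeasure 1))))
        ≤ C / Real.sqrt (Real.log n) := by
  obtain ⟨c, n₀, hrate⟩ := hrate
  obtain ⟨ht0, ht1⟩ := ht
  have ht1' : 0 < 1 - t := by linarith
  refine ⟨2 * (2 * (4 * recordConst + 4) + (2 / t * (c + 1) + 2 / (1 - t) * (c + 1))),
    eventually_atTop.1 ?_⟩
  have hlog : Tendsto (fun n : ℕ => Real.log n) atTop atTop :=
    Real.tendsto_log_atTop.comp tendsto_natCast_atTop_atTop
  have hsmall : Tendsto (fun n : ℕ => (c + 1) / √(Real.log n)) atTop (nhds 0) :=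
    tendsto_const_nhds.div_atTop (Real.tendsto_sqrt_atTop.comp hlog)
  filter_upwards [eventually_ge_atTop n₀, eventually_ge_atTop 1, hlog.eventually_gt_atTop 0,
    (hlog.const_mul_atTop (by norm_num : (0 : ℝ) < 3 / 4)).eventually_ge_atTop
      (-Real.log (t / 2)),
    (hlog.const_mul_atTop (by norm_num : (0 : ℝ) < 3 / 4)).eventually_ge_atTop
      (-Real.log ((1 - t) / 2)),
    hsmall.eventually_le_const (half_pos ht0), hsmall.eventually_le_const (half_pos ht1')]
    with n hn hn1 hpos hl1 hl2 hs1 hs2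
  have hln := Finset.mem_Icc.1 (hl n hn1)
  have hr := hrate n hn
  obtain ⟨a, ha⟩ : ∃ a, l n = a + 1 := ⟨l n - 1, by omega⟩
  obtain ⟨b, hb⟩ : ∃ b, n = a + b + 1 := ⟨n - l n, by omega⟩
  have hn0 : (0 : ℝ) < n := by exact_mod_cast hn1
  have hsq : 0 < √(Real.log n) := Real.sqrt_pos.2 hpos
  have hinv : 1 / (n : ℝ) ≤ 1 / √(Real.log n) := by
    refine one_div_le_one_div_of_le hsq (Real.sqrt_le_iff.2 ⟨hn0.le, ?_⟩)
    have h1 : (1 : ℝ) ≤ n := by exact_mod_cast hn1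
    nlinarith [Real.log_le_self hn0.le]
  rw [ha] at hr ⊢
  push_cast at hr
  have h1 : |((a : ℝ) + 1) / n - t| ≤ (c + 1) / √(Real.log n) := by
    rw [add_div c]
    linarith [one_div_pos.2 hsq]
  have h2 : |((b : ℝ) + 1) / n - (1 - t)| ≤ (c + 1) / √(Real.log n) := by
    have e : ((b : ℝ) + 1) / n - (1 - t) = 1 / n - (((a : ℝ) + 1) / n - t) := by
      have : (n : ℝ) = a + b + 1 := by rw [hb]; push_cast; ring
      field_simp
      linarith
    rw [e, add_div c]
    refine (abs_sub _ _).trans ?_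
    rw [abs_of_pos (one_div_pos.2 hn0)]
    linarith
  obtain ⟨hA1, hA2⟩ := side_bounds ht0 hpos hl1 h1 hs1
  obtain ⟨hB1, hB2⟩ := side_bounds ht1' hpos hl2 h2 hs2
  have hfin := dW_bstDepth_mixPo_le a b (2 * Real.log n + 2 * Real.eulerMascheroniConstant +
    Real.log (t * (1 - t)))
  rw [← hb] at hfin
  refine hfin.trans ?_
  have hD : |2 * Real.eulerMascheroniConstant + Real.log (a + 1) + Real.log (b + 1) -
      (2 * Real.log n + 2 * Real.eulerMascheroniConstant + Real.log (t * (1 - t)))| ≤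
      2 / t * (c + 1) / √(Real.log n) + 2 / (1 - t) * (c + 1) / √(Real.log n) := by
    rw [Real.log_mul ht0.ne' ht1'.ne', show 2 * Real.eulerMascheroniConstant + Real.log (a + 1) +
      Real.log (b + 1) - (2 * Real.log n + 2 * Real.eulerMascheroniConstant +
        (Real.log t + Real.log (1 - t))) = (Real.log (a + 1) - Real.log n - Real.log t) +
        (Real.log (b + 1) - Real.log n - Real.log (1 - t)) by ring]
    exact (abs_add_le _ _).trans (add_le_add hA2 hB2)
  rw [mul_div_assoc, add_div, add_div, mul_div_assoc]
  linarith
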